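/- arXiv:1806.04701 — 4 statements merged into one kernel-verified Lean document; each statement's English description precedes it below -/
import Mathlib

section
/- Let μ = (μ_1,…,μ_{n/2}) be the random vector with joint density Z_n^{-1}|Δ(μ)|² e^{−Σ_{j=1}^{n/2} μ_j²/2} on Σ_n, and γ_n ∈ X the associated random element. Then for every x ∈ X and every ε ∈ (0,1), liminf_{n→∞, n even} (4/n²) ln P(d(γ_n, x) < ε) ≥ −x_0 + 1 + ln J(x) = −I(x), where ln 0 is interpreted as −∞. -/
open MeasureTheory BoundedContinuousFunction Filter

noncomputable section

/-- Membership in the space `X ⊆ l^∞`: `x_j ≥ x_{j+1} ≥ 0` for `j ≥ 1` and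
`Σ_{j=1}^∞ x_j² ≤ x_0` (the series being summable). Bounded sequences are modeled as
bounded (continuous) functions `ℕ →ᵇ ℝ`, whose distance is the sup metric `d`. -/
def memX (x : ℕ →ᵇ ℝ) : Prop :=
  (∀ j : ℕ, 1 ≤ j → 0 ≤ x (j + 1) ∧ x (j + 1) ≤ x j) ∧
  Summable (fun j : ℕ => (x (j + 1)) ^ 2) ∧ (∑' j : ℕ, (x (j + 1)) ^ 2) ≤ x 0

def setX : Set (ℕ →ᵇ ℝ) := {x | memX x}

/-- `J(x) = x_0 − Σ_{j=1}^∞ x_j²`. -/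
def Jfun (x : ℕ →ᵇ ℝ) : ℝ := x 0 - ∑' j : ℕ, (x (j + 1)) ^ 2

/-- The rate function `I(x) = x_0 − 1 − ln J(x)` for `J(x) > 0`, and `+∞` when `J(x) = 0`. -/
def Ifun (x : ℕ →ᵇ ℝ) : EReal :=
  if 0 < Jfun x then ((x 0 - 1 - Real.log (Jfun x) : ℝ) : EReal) else ⊤

/-- The open Weyl chamber `Σ_n`: strictly decreasing positive vectors. -/
def SigmaN (m : ℕ) : Set (Fin m → ℝ) :=
  {μ | (∀ i j : Fin m, i < j → μ j < μ i) ∧ ∀ i, 0 < μ i}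

/-- The Vandermonde-type determinant `Δ(μ) = ∏_{i<j} (μ_i² − μ_j²)`. -/
def VdM (m : ℕ) (μ : Fin m → ℝ) : ℝ :=
  ∏ p ∈ Finset.univ.filter (fun p : Fin m × Fin m => p.1 < p.2), (μ p.1 ^ 2 - μ p.2 ^ 2)

/-- The normalization constant `Z_n = (π/2)^{n/4} ∏_{j=0}^{n/2−1} (2j)!`. -/
def Zn (n : ℕ) : ℝ :=
  (Real.pi / 2) ^ ((n : ℝ) / 4) * ∏ j ∈ Finset.range (n / 2), (Nat.factorial (2 * j) : ℝ)

/-- The law of `μ = (μ_1, …, μ_{n/2})`: the probability measure on `ℝ^{n/2}` with density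
`Z_n^{-1} |Δ(μ)|² e^{−Σ μ_j²/2}` on `Σ_{n}` with respect to Lebesgue measure. -/
def Pn (n : ℕ) : Measure (Fin (n / 2) → ℝ) :=
  (volume.restrict (SigmaN (n / 2))).withDensity
    (fun μ => ENNReal.ofReal ((Zn n)⁻¹ * (VdM (n / 2) μ) ^ 2 * Real.exp (-(∑ j, μ j ^ 2) / 2)))

/-- `γ` is the family of random elements `γ_n ∈ X` associated with `μ`:
`(γ_n)_0 = C(n,2)^{-1} Σ_j μ_j²`, `(γ_n)_j = C(n,2)^{-1/2} μ_j` for `1 ≤ j ≤ n/2`, and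
`(γ_n)_j = 0` for `j > n/2` (characterized on `Σ_n`, which has full `Pn`-measure). -/
def IsGammaN (γ : (n : ℕ) → (Fin (n / 2) → ℝ) → (ℕ →ᵇ ℝ)) : Prop :=
  ∀ n : ℕ, Even n → 0 < n → ∀ μ ∈ SigmaN (n / 2),
    γ n μ ∈ setX ∧
    (γ n μ) 0 = (n.choose 2 : ℝ)⁻¹ * ∑ j, μ j ^ 2 ∧
    (∀ j : Fin (n / 2), (γ n μ) ((j : ℕ) + 1) = (Real.sqrt (n.choose 2))⁻¹ * μ j) ∧
    (∀ j : ℕ, n / 2 < j → (γ n μ) j = 0)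

/-- The Gaussian functional `p ↦ ∫ p(t) e^{-t²/2} dt` on real polynomials. -/
def gaussInt (p : Polynomial ℝ) : ℝ := ∫ t : ℝ, p.eval t * Real.exp (-(t ^ 2 / 2))

theorem integrable_eval_mul_exp (p : Polynomial ℝ) :
    Integrable (fun t : ℝ => p.eval t * Real.exp (-(t ^ 2 / 2))) := by
  induction p using Polynomial.induction_on' with
  | add p q hp hq =>
    simp only [Polynomial.eval_add, add_mul]
    exact hp.add hq
  | monomial n a =>
    have h := integrable_rpow_mul_exp_neg_mul_sq (b := 1 / 2) (by norm_num) (s := n)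
      (by have : (0 : ℝ) ≤ n := n.cast_nonneg
          linarith)
    refine (h.const_mul a).congr (ae_of_all _ fun t => ?_)
    simp only [Polynomial.eval_monomial, Real.rpow_natCast]
    rw [mul_assoc]
    congr 3
    ring

theorem gaussInt_add (p q : Polynomial ℝ) : gaussInt (p + q) = gaussInt p + gaussInt q := by
  simp only [gaussInt, Polynomial.eval_add, add_mul]
  exact integral_add (integrable_eval_mul_exp p) (integrable_eval_mul_exp q)

theorem gaussInt_sub (p q : Polynomial ℝ) : gaussInt (p - q) = gaussInt p - gaussInt q := by
  simp only [gaussInt, Polynomial.eval_sub, sub_mul]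
  exact integral_sub (integrable_eval_mul_exp p) (integrable_eval_mul_exp q)

theorem gaussInt_X_mul (p : Polynomial ℝ) :
    gaussInt (Polynomial.X * p) = gaussInt (Polynomial.derivative p) := by
  have hd : ∀ t : ℝ, HasDerivAt (fun t : ℝ => p.eval t * Real.exp (-(t ^ 2 / 2)))
      ((Polynomial.derivative p - Polynomial.X * p).eval t * Real.exp (-(t ^ 2 / 2))) t := by
    intro t
    have h1 : HasDerivAt (fun t : ℝ => Real.exp (-(t ^ 2 / 2)))
        (Real.exp (-(t ^ 2 / 2)) * (-t)) t := by
      refine HasDerivAt.exp ?_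
      refine ((hasDerivAt_pow 2 t).div_const 2).neg.congr_deriv ?_
      push_cast
      ring
    refine ((p.hasDerivAt t).mul h1).congr_deriv ?_
    simp only [Polynomial.eval_sub, Polynomial.eval_mul, Polynomial.eval_X]
    ring
  have h0 := integral_eq_zero_of_hasDerivAt_of_integrable hd
    (integrable_eval_mul_exp _) (integrable_eval_mul_exp p)
  have h1 : gaussInt (Polynomial.derivative p - Polynomial.X * p) = 0 := h0
  rw [gaussInt_sub] at h1
  linarith

/-- Hermite polynomials with real coefficients. -/
def hermiteReal (n : ℕ) : Polynomial ℝ := (Polynomial.hermite n).map (Int.castRingHom ℝ)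

theorem gaussInt_hermiteReal_mul (n : ℕ) (q : Polynomial ℝ) :
    gaussInt (hermiteReal n * q) = gaussInt (Polynomial.derivative^[n] q) := by
  induction n generalizing q with
  | zero => simp [hermiteReal]
  | succ n ih =>
    have h : hermiteReal (n + 1) * q = Polynomial.X * (hermiteReal n * q)
        - Polynomial.derivative (hermiteReal n * q)
        + hermiteReal n * Polynomial.derivative q := by
      simp only [hermiteReal, Polynomial.hermite_succ, Polynomial.map_sub, Polynomial.map_mul,
        Polynomial.map_X, Polynomial.derivative_mul, Polynomial.derivative_map]
      ring
    rw [h, gaussInt_add, gaussInt_sub, gaussInt_X_mul, sub_self, zero_add, ih,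
      Function.iterate_succ_apply]

theorem hermiteReal_monic (n : ℕ) : (hermiteReal n).Monic :=
  (Polynomial.hermite_monic n).map _

theorem natDegree_hermiteReal (n : ℕ) : (hermiteReal n).natDegree = n := by
  rw [hermiteReal, (Polynomial.hermite_monic n).natDegree_map, Polynomial.natDegree_hermite]

theorem gaussInt_one : gaussInt 1 = Real.sqrt (2 * Real.pi) := by
  have h := integral_gaussian (1 / 2)
  have e : gaussInt 1 = ∫ x : ℝ, Real.exp (-(1 / 2) * x ^ 2) := by
    unfold gaussInt
    congr 1
    ext t
    rw [Polynomial.eval_one, one_mul]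
    congr 1
    ring
  rw [e, h]
  congr 1
  ring

theorem gaussInt_hermiteReal_mul_hermiteReal (i j : ℕ) :
    gaussInt (hermiteReal i * hermiteReal j) =
      if i = j then (i.factorial : ℝ) * Real.sqrt (2 * Real.pi) else 0 := by
  have key : ∀ i j : ℕ, j < i → gaussInt (hermiteReal i * hermiteReal j) = 0 := by
    intro i j hij
    rw [gaussInt_hermiteReal_mul, Polynomial.iterate_derivative_eq_zero
      (by rwa [natDegree_hermiteReal])]
    simp [gaussInt]
  rcases lt_trichotomy i j with h | h | h
  · rw [if_neg h.ne, mul_comm, key j i h]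
  · subst h
    rw [if_pos rfl, gaussInt_hermiteReal_mul]
    have hc : Polynomial.derivative^[i] (hermiteReal i) = Polynomial.C (i.factorial : ℝ) := by
      have hdeg : (Polynomial.derivative^[i] (hermiteReal i)).natDegree ≤ 0 := by
        have := Polynomial.natDegree_iterate_derivative (hermiteReal i) i
        rwa [natDegree_hermiteReal, Nat.sub_self] at this
      rw [Polynomial.eq_C_of_natDegree_le_zero hdeg, Polynomial.coeff_iterate_derivative]
      have : (hermiteReal i).coeff i = 1 := by
        have := hermiteReal_monic i
        rwa [Polynomial.Monic, Polynomial.leadingCoeff, natDegree_hermiteReal] at this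
      simp [this, Nat.descFactorial_self]
    rw [hc, ← gaussInt_one, gaussInt, gaussInt, ← integral_const_mul]
    simp
  · rw [if_neg h.ne', key i j h]

/-- The monic polynomial `p_i` of degree `i` with `p_i(t²) = He_{2i}(t)`. -/
def evenHermite (i : ℕ) : Polynomial ℝ := Polynomial.contract 2 (hermiteReal (2 * i))

theorem expand_evenHermite (i : ℕ) :
    Polynomial.expand ℝ 2 (evenHermite i) = hermiteReal (2 * i) := by
  ext k
  rw [Polynomial.coeff_expand (by norm_num)]
  split_ifs with h
  · rw [evenHermite, Polynomial.coeff_contract (by norm_num), Nat.div_mul_cancel h]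
  · have : Odd (2 * i + k) := by
      rcases Nat.even_or_odd k with hk | hk
      · exact absurd hk.two_dvd h
      · exact (even_two_mul i).add_odd hk
    simp [hermiteReal, Polynomial.coeff_map, Polynomial.coeff_hermite_of_odd_add this]

theorem natDegree_evenHermite (i : ℕ) : (evenHermite i).natDegree = i := by
  have h := Polynomial.natDegree_expand 2 (evenHermite i)
  rw [expand_evenHermite, natDegree_hermiteReal] at h
  omega

theorem evenHermite_monic (i : ℕ) : (evenHermite i).Monic := by
  rw [← Polynomial.monic_expand_iff (p := 2) (by norm_num), expand_evenHermite]
  exact hermiteReal_monic _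

theorem eval_sq_evenHermite (i : ℕ) (t : ℝ) :
    (evenHermite i).eval (t ^ 2) = (hermiteReal (2 * i)).eval t := by
  rw [← expand_evenHermite, Polynomial.expand_eval]

theorem integrableOn_evenHermite_mul (i j : ℕ) :
    Integrable (fun t : ℝ => (evenHermite i).eval (t ^ 2) * (evenHermite j).eval (t ^ 2) *
      Real.exp (-(t ^ 2 / 2))) (volume.restrict (Set.Ioi 0)) := by
  simp only [eval_sq_evenHermite, ← Polynomial.eval_mul]
  exact (integrable_eval_mul_exp _).restrict

theorem integral_evenHermite_mul (i j : ℕ) :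
    ∫ t in Set.Ioi (0 : ℝ), (evenHermite i).eval (t ^ 2) * (evenHermite j).eval (t ^ 2) *
      Real.exp (-(t ^ 2 / 2)) =
      if i = j then ((2 * i).factorial : ℝ) * Real.sqrt (Real.pi / 2) else 0 := by
  have h := integral_comp_abs (f := fun t : ℝ => (evenHermite i).eval (t ^ 2) *
    (evenHermite j).eval (t ^ 2) * Real.exp (-(t ^ 2 / 2)))
  simp only [sq_abs] at h
  have h2 := gaussInt_hermiteReal_mul_hermiteReal (2 * i) (2 * j)
  simp only [gaussInt, Polynomial.eval_mul, ← eval_sq_evenHermite] at h2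
  rw [h2] at h
  have hs : Real.sqrt (2 * Real.pi) = 2 * Real.sqrt (Real.pi / 2) := by
    rw [show 2 * Real.pi = 2 ^ 2 * (Real.pi / 2) by ring, Real.sqrt_mul (by norm_num),
      Real.sqrt_sq (by norm_num)]
  by_cases hij : i = j
  · rw [if_pos (by rw [hij]), hs] at h
    rw [if_pos hij]
    linarith
  · rw [if_neg (by omega)] at h
    rw [if_neg hij]
    linarith

theorem VdM_sq_eq_det_vandermonde_sq (m : ℕ) (μ : Fin m → ℝ) :
    VdM m μ ^ 2 = (Matrix.vandermonde fun i => μ i ^ 2).det ^ 2 := by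
  rw [Matrix.det_vandermonde, VdM, Finset.prod_filter, ← Finset.univ_product_univ,
    Finset.prod_product, ← Finset.prod_pow, ← Finset.prod_pow]
  refine Finset.prod_congr rfl fun i _ => ?_
  rw [← Finset.prod_filter, ← Finset.prod_pow, ← Finset.prod_pow]
  refine Finset.prod_congr (by ext j; simp) fun j _ => ?_
  ring

theorem VdM_comp_perm_sq (m : ℕ) (μ : Fin m → ℝ) (σ : Equiv.Perm (Fin m)) :
    VdM m (μ ∘ σ) ^ 2 = VdM m μ ^ 2 := by
  rw [VdM_sq_eq_det_vandermonde_sq, VdM_sq_eq_det_vandermonde_sq]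
  have h : (Matrix.vandermonde fun i => (μ ∘ σ) i ^ 2) =
      (Matrix.vandermonde fun i => μ i ^ 2).submatrix σ id := by
    ext i j
    simp [Matrix.vandermonde_apply]
  rw [h, Matrix.det_permute, mul_pow]
  rcases Int.units_eq_one_or (Equiv.Perm.sign σ) with h | h <;> simp [h]

theorem VdM_eq_zero_of_not_injective (m : ℕ) (μ : Fin m → ℝ) (h : ¬ Function.Injective μ) :
    VdM m μ = 0 := by
  have : (Matrix.vandermonde fun i => μ i ^ 2).det = 0 := by
    rw [Matrix.det_vandermonde_eq_zero_iff]
    simp only [Function.Injective, not_forall] at h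
    obtain ⟨i, j, hij, hne⟩ := h
    exact ⟨i, j, by simp only [hij], hne⟩
  have h2 := VdM_sq_eq_det_vandermonde_sq m μ
  rw [this] at h2
  simpa using h2

theorem VdM_sq_eq_sum (m : ℕ) (μ : Fin m → ℝ) :
    VdM m μ ^ 2 = ∑ σ : Equiv.Perm (Fin m), ∑ τ : Equiv.Perm (Fin m),
      ((Equiv.Perm.sign σ : ℤ) : ℝ) * ((Equiv.Perm.sign τ : ℤ) : ℝ) *
        ∏ i, ((evenHermite (σ i)).eval (μ i ^ 2) * (evenHermite (τ i)).eval (μ i ^ 2)) := by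
  have h : (Matrix.vandermonde fun i => μ i ^ 2).det =
      ∑ σ : Equiv.Perm (Fin m), ((Equiv.Perm.sign σ : ℤ) : ℝ) *
        ∏ i, (evenHermite (σ i)).eval (μ i ^ 2) := by
    rw [Matrix.det_eval_matrixOfPolynomials_eq_det_vandermonde _ (fun j => evenHermite j)
      (fun j => natDegree_evenHermite j) (fun j => evenHermite_monic j), ← Matrix.det_transpose,
      Matrix.det_apply']
    simp
  rw [VdM_sq_eq_det_vandermonde_sq, h, sq, Finset.sum_mul_sum]
  refine Finset.sum_congr rfl fun σ _ => Finset.sum_congr rfl fun τ _ => ?_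
  rw [Finset.prod_mul_distrib]
  ring

/-- The unnormalized density `Δ(μ)² e^{-s Σ μ_j²/2}`. -/
def dens (m : ℕ) (s : ℝ) (μ : Fin m → ℝ) : ℝ :=
  VdM m μ ^ 2 * Real.exp (-(s * ∑ j, μ j ^ 2) / 2)

theorem dens_nonneg (m : ℕ) (s : ℝ) (μ : Fin m → ℝ) : 0 ≤ dens m s μ :=
  mul_nonneg (sq_nonneg _) (Real.exp_nonneg _)

theorem continuous_dens (m : ℕ) (s : ℝ) : Continuous (dens m s) := by
  unfold dens VdM
  fun_prop

theorem dens_comp_perm (m : ℕ) (s : ℝ) (μ : Fin m → ℝ) (σ : Equiv.Perm (Fin m)) :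
    dens m s (μ ∘ σ) = dens m s μ := by
  simp only [dens, VdM_comp_perm_sq]
  have := Equiv.sum_comp σ (fun j => μ j ^ 2)
  simp only [Function.comp_apply, this]

/-- The normalization constant indexed by the number of particles. -/
def partition (m : ℕ) : ℝ := ∏ i ∈ Finset.range m, ((2 * i).factorial * Real.sqrt (Real.pi / 2))

theorem dens_one_eq_sum (m : ℕ) (μ : Fin m → ℝ) :
    dens m 1 μ = ∑ σ : Equiv.Perm (Fin m), ∑ τ : Equiv.Perm (Fin m),
      ((Equiv.Perm.sign σ : ℤ) : ℝ) * ((Equiv.Perm.sign τ : ℤ) : ℝ) *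
        ∏ i, ((evenHermite (σ i)).eval (μ i ^ 2) * (evenHermite (τ i)).eval (μ i ^ 2) *
          Real.exp (-(μ i ^ 2 / 2))) := by
  have he : Real.exp (-(1 * ∑ j, μ j ^ 2) / 2) = ∏ i, Real.exp (-(μ i ^ 2 / 2)) := by
    rw [← Real.exp_sum]
    congr 1
    rw [one_mul, Finset.sum_neg_distrib, neg_div, Finset.sum_div]
  rw [dens, VdM_sq_eq_sum, he, Finset.sum_mul]
  refine Finset.sum_congr rfl fun σ _ => ?_
  rw [Finset.sum_mul]
  refine Finset.sum_congr rfl fun τ _ => ?_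
  rw [mul_assoc, ← Finset.prod_mul_distrib]

theorem integrable_dens_one_positive (m : ℕ) :
    Integrable (dens m 1) (Measure.pi fun _ : Fin m => volume.restrict (Set.Ioi (0 : ℝ))) := by
  have : dens m 1 = fun μ => _ := funext (dens_one_eq_sum m)
  rw [this]
  refine integrable_finsetSum _ fun σ _ => integrable_finsetSum _ fun τ _ =>
    Integrable.const_mul ?_ _
  exact Integrable.fintype_prod (f := fun (i : Fin m) (t : ℝ) =>
    (evenHermite (σ i)).eval (t ^ 2) * (evenHermite (τ i)).eval (t ^ 2) *
      Real.exp (-(t ^ 2 / 2))) fun i => integrableOn_evenHermite_mul _ _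

theorem integral_dens_one_positive (m : ℕ) :
    ∫ μ, dens m 1 μ ∂(Measure.pi fun _ : Fin m => volume.restrict (Set.Ioi (0 : ℝ))) =
      m.factorial * partition m := by
  simp only [dens_one_eq_sum]
  have hintegrable : ∀ σ τ : Equiv.Perm (Fin m), Integrable (fun μ : Fin m → ℝ =>
      ((Equiv.Perm.sign σ : ℤ) : ℝ) * ((Equiv.Perm.sign τ : ℤ) : ℝ) *
        ∏ i, ((evenHermite (σ i)).eval (μ i ^ 2) * (evenHermite (τ i)).eval (μ i ^ 2) *
          Real.exp (-(μ i ^ 2 / 2))))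
      (Measure.pi fun _ : Fin m => volume.restrict (Set.Ioi (0 : ℝ))) := by
    intro σ τ
    refine Integrable.const_mul ?_ _
    exact Integrable.fintype_prod (f := fun (i : Fin m) (t : ℝ) =>
      (evenHermite (σ i)).eval (t ^ 2) * (evenHermite (τ i)).eval (t ^ 2) *
        Real.exp (-(t ^ 2 / 2))) fun i => integrableOn_evenHermite_mul _ _
  rw [integral_finsetSum _ fun σ _ => integrable_finsetSum _ fun τ _ => hintegrable σ τ]
  have hσ : ∀ σ : Equiv.Perm (Fin m), ∫ μ, (∑ τ : Equiv.Perm (Fin m),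
      ((Equiv.Perm.sign σ : ℤ) : ℝ) * ((Equiv.Perm.sign τ : ℤ) : ℝ) *
        ∏ i, ((evenHermite (σ i)).eval (μ i ^ 2) * (evenHermite (τ i)).eval (μ i ^ 2) *
          Real.exp (-(μ i ^ 2 / 2))))
      ∂(Measure.pi fun _ : Fin m => volume.restrict (Set.Ioi (0 : ℝ))) = partition m := by
    intro σ
    rw [integral_finsetSum _ fun τ _ => hintegrable σ τ]
    have hτ : ∀ τ : Equiv.Perm (Fin m), ∫ μ, ((Equiv.Perm.sign σ : ℤ) : ℝ) *
        ((Equiv.Perm.sign τ : ℤ) : ℝ) *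
        ∏ i, ((evenHermite (σ i)).eval (μ i ^ 2) * (evenHermite (τ i)).eval (μ i ^ 2) *
          Real.exp (-(μ i ^ 2 / 2)))
        ∂(Measure.pi fun _ : Fin m => volume.restrict (Set.Ioi (0 : ℝ))) =
        if τ = σ then partition m else 0 := by
      intro τ
      rw [integral_const_mul, integral_fintype_prod_eq_prod (f := fun (i : Fin m) (t : ℝ) =>
        (evenHermite (σ i)).eval (t ^ 2) * (evenHermite (τ i)).eval (t ^ 2) *
          Real.exp (-(t ^ 2 / 2)))]
      simp only [integral_evenHermite_mul]
      split_ifs with h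
      · subst h
        have hs : ((Equiv.Perm.sign τ : ℤ) : ℝ) * ((Equiv.Perm.sign τ : ℤ) : ℝ) = 1 := by
          rcases Int.units_eq_one_or (Equiv.Perm.sign τ) with h | h <;> simp [h]
        simp only [hs, one_mul, if_true]
        rw [Equiv.prod_comp τ (fun i : Fin m => ((2 * (i : ℕ)).factorial : ℝ) *
          Real.sqrt (Real.pi / 2)), partition, Finset.prod_range]
      · obtain ⟨i, hi⟩ : ∃ i, τ i ≠ σ i := by
          by_contra! hc
          exact h (Equiv.ext hc)
        rw [Finset.prod_eq_zero (Finset.mem_univ i), mul_zero]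
        rw [if_neg]
        exact fun hc => hi (Fin.ext hc.symm)
    simp only [hτ]
    simp
  simp only [hσ]
  simp [Fintype.card_perm]

/-- The unnormalized mass `∫_S Δ(μ)² e^{-s Σ μ_j²/2} dμ`. -/
def mass (m : ℕ) (s : ℝ) (S : Set (Fin m → ℝ)) : ENNReal :=
  ∫⁻ μ in S, ENNReal.ofReal (dens m s μ)

theorem measurableSet_SigmaN (m : ℕ) : MeasurableSet (SigmaN m) := by
  have : SigmaN m = (⋂ i : Fin m, ⋂ j : Fin m, {μ | i < j → μ j < μ i}) ∩
      ⋂ i : Fin m, {μ | 0 < μ i} := by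
    ext μ
    simp [SigmaN]
  rw [this]
  refine (MeasurableSet.iInter fun i => MeasurableSet.iInter fun j => ?_).inter
    (MeasurableSet.iInter fun i => measurableSet_lt measurable_const (measurable_pi_apply i))
  by_cases h : i < j
  · simpa [h] using measurableSet_lt (measurable_pi_apply j) (measurable_pi_apply i)
  · simp [h]

theorem SigmaN_strictAnti {m : ℕ} {μ : Fin m → ℝ} (h : μ ∈ SigmaN m) : StrictAnti μ :=
  fun i j hij => h.1 i j hij

theorem positive_inter_injective_eq_iUnion (m : ℕ) :
    (Set.univ.pi fun _ : Fin m => Set.Ioi (0 : ℝ)) ∩ {μ | Function.Injective μ} =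
      ⋃ σ : Equiv.Perm (Fin m), {μ : Fin m → ℝ | μ ∘ σ ∈ SigmaN m} := by
  ext μ
  simp only [Set.mem_inter_iff, Set.mem_pi, Set.mem_univ, true_imp_iff, Set.mem_Ioi,
    Set.mem_ofPred_eq, Set.mem_iUnion]
  constructor
  · rintro ⟨hp, hi⟩
    refine ⟨Tuple.sort (-μ), fun i j hij => ?_, fun i => hp _⟩
    have hm := Tuple.monotone_sort (-μ) hij.le
    simp only [Function.comp_apply, Pi.neg_apply, neg_le_neg_iff] at hm
    refine lt_of_le_of_ne hm fun he => ?_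
    exact hij.ne' ((Tuple.sort (-μ)).injective (hi he))
  · rintro ⟨σ, hσ⟩
    refine ⟨fun i => ?_, ?_⟩
    · simpa using hσ.2 (σ.symm i)
    · have := (SigmaN_strictAnti hσ).injective
      have h2 := this.comp σ.symm.injective
      simpa [Function.comp_assoc] using h2

theorem pairwise_disjoint_SigmaN_perm (m : ℕ) :
    Pairwise (Function.onFun Disjoint
      fun σ : Equiv.Perm (Fin m) => {μ : Fin m → ℝ | μ ∘ σ ∈ SigmaN m}) := by
  intro σ τ hne
  rw [Function.onFun, Set.disjoint_left]
  intro μ hσ hτ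
  apply hne
  have h1 : Monotone ((-μ) ∘ σ) := fun i j hij =>
    neg_le_neg ((SigmaN_strictAnti hσ).antitone hij)
  have h2 : Monotone ((-μ) ∘ τ) := fun i j hij =>
    neg_le_neg ((SigmaN_strictAnti hτ).antitone hij)
  have h3 := Tuple.unique_monotone h1 h2
  have hinj : Function.Injective μ := by
    have h2 := (SigmaN_strictAnti hσ).injective.comp σ.symm.injective
    simpa [Function.comp_assoc] using h2
  ext i
  have h4 := congrFun h3 i
  simp only [Function.comp_apply, Pi.neg_apply, neg_inj] at h4
  rw [hinj h4]

theorem setLIntegral_dens_perm (m : ℕ) (s : ℝ) (σ : Equiv.Perm (Fin m)) :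
    ∫⁻ μ in {μ : Fin m → ℝ | μ ∘ σ ∈ SigmaN m}, ENNReal.ofReal (dens m s μ) =
      mass m s (SigmaN m) := by
  have hmp := volume_measurePreserving_piCongrLeft (fun _ : Fin m => ℝ) σ.symm
  have hcoe : ∀ μ : Fin m → ℝ,
      (MeasurableEquiv.piCongrLeft (fun _ : Fin m => ℝ) σ.symm) μ = μ ∘ σ := by
    intro μ
    ext i
    have := Equiv.piCongrLeft_apply_apply (fun _ : Fin m => ℝ) σ.symm μ (σ i)
    simpa [MeasurableEquiv.coe_piCongrLeft] using this
  have h := hmp.setLIntegral_comp_preimage_emb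
    (MeasurableEquiv.measurableEmbedding _) (fun μ => ENNReal.ofReal (dens m s μ)) (SigmaN m)
  simp only [hcoe, dens_comp_perm] at h
  rw [mass, ← h]
  congr 1
  congr 1
  ext μ
  simp [hcoe]

theorem mass_one_SigmaN (m : ℕ) : mass m 1 (SigmaN m) = ENNReal.ofReal (partition m) := by
  have hf : ((m.factorial : ℕ) : ENNReal) ≠ 0 := by exact_mod_cast m.factorial_ne_zero
  have hmeas : ∀ σ : Equiv.Perm (Fin m), MeasurableSet {μ : Fin m → ℝ | μ ∘ σ ∈ SigmaN m} := by
    intro σ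
    have : Measurable fun μ : Fin m → ℝ => μ ∘ σ := by fun_prop
    exact this (measurableSet_SigmaN m)
  have h1 : ∫⁻ μ in (Set.univ.pi fun _ : Fin m => Set.Ioi (0 : ℝ)),
      ENNReal.ofReal (dens m 1 μ) = m.factorial * mass m 1 (SigmaN m) := by
    have hU : MeasurableSet (⋃ σ : Equiv.Perm (Fin m), {μ : Fin m → ℝ | μ ∘ σ ∈ SigmaN m}) :=
      MeasurableSet.iUnion hmeas
    rw [← lintegral_inter_add_sdiff _ (Set.univ.pi fun _ : Fin m => Set.Ioi (0 : ℝ)) hU]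
    have hsub : (⋃ σ : Equiv.Perm (Fin m), {μ : Fin m → ℝ | μ ∘ σ ∈ SigmaN m}) ⊆
        Set.univ.pi fun _ : Fin m => Set.Ioi (0 : ℝ) := by
      rw [← positive_inter_injective_eq_iUnion]
      exact Set.inter_subset_left
    rw [Set.inter_eq_right.mpr hsub, lintegral_iUnion hmeas (pairwise_disjoint_SigmaN_perm m)]
    have hz : ∫⁻ μ in (Set.univ.pi fun _ : Fin m => Set.Ioi (0 : ℝ)) \
        (⋃ σ : Equiv.Perm (Fin m), {μ : Fin m → ℝ | μ ∘ σ ∈ SigmaN m}),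
        ENNReal.ofReal (dens m 1 μ) = 0 := by
      rw [setLIntegral_congr_fun (g := fun _ => 0)
        ((MeasurableSet.univ_pi fun _ => measurableSet_Ioi).diff hU)]
      · simp
      · intro μ hμ
        have : ¬ Function.Injective μ := by
          intro hi
          apply hμ.2
          rw [← positive_inter_injective_eq_iUnion]
          exact ⟨hμ.1, hi⟩
        simp [dens, VdM_eq_zero_of_not_injective m μ this]
    rw [hz, add_zero]
    simp only [setLIntegral_dens_perm]
    simp [tsum_fintype, Fintype.card_perm]
  have h2 : ∫⁻ μ in (Set.univ.pi fun _ : Fin m => Set.Ioi (0 : ℝ)),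
      ENNReal.ofReal (dens m 1 μ) = m.factorial * ENNReal.ofReal (partition m) := by
    rw [volume_pi, Measure.restrict_pi_pi, ← ofReal_integral_eq_lintegral_ofReal
      (integrable_dens_one_positive m) (ae_of_all _ fun μ => dens_nonneg m 1 μ),
      integral_dens_one_positive, ENNReal.ofReal_mul (by positivity), ENNReal.ofReal_natCast]
  rw [h1] at h2
  exact (ENNReal.mul_right_inj hf (ENNReal.natCast_ne_top _)).mp h2

/-- The number `C(2m, 2)` of degrees of freedom of `Σ μ_j²`. -/
def dof (m : ℕ) : ℕ := (2 * m).choose 2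

theorem dof_eq (m : ℕ) : (dof m : ℝ) = m * (2 * m - 1) := by
  rw [dof, Nat.cast_choose_two]
  push_cast
  ring

theorem dof_succ (m : ℕ) : dof (m + 1) = dof m + (4 * m + 1) := by
  have h : (dof (m + 1) : ℝ) = dof m + (4 * m + 1) := by
    rw [dof_eq, dof_eq]
    push_cast
    ring
  exact_mod_cast h

theorem VdM_eq_prod_prod (m : ℕ) (μ : Fin m → ℝ) :
    VdM m μ = ∏ i, ∏ j ∈ Finset.Ioi i, (μ i ^ 2 - μ j ^ 2) := by
  rw [VdM, Finset.prod_filter, ← Finset.univ_product_univ, Finset.prod_product]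
  refine Finset.prod_congr rfl fun i _ => ?_
  rw [← Finset.prod_filter]
  exact Finset.prod_congr (by ext j; simp) fun j _ => rfl

theorem VdM_cons (m : ℕ) (t : ℝ) (ν : Fin m → ℝ) :
    VdM (m + 1) (Fin.cons t ν : Fin (m + 1) → ℝ) = (∏ j, (t ^ 2 - ν j ^ 2)) * VdM m ν := by
  rw [VdM_eq_prod_prod, VdM_eq_prod_prod, Fin.prod_univ_succ, Fin.prod_Ioi_zero]
  simp [Fin.prod_Ioi_succ]

theorem dens_cons (m : ℕ) (s t : ℝ) (ν : Fin m → ℝ) :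
    dens (m + 1) s (Fin.cons t ν : Fin (m + 1) → ℝ) =
      (∏ j, (t ^ 2 - ν j ^ 2) ^ 2) * Real.exp (-(s * t ^ 2) / 2) * dens m s ν := by
  rw [dens, dens, VdM_cons, Fin.sum_univ_succ, Finset.prod_pow]
  simp only [Fin.cons_zero, Fin.cons_succ]
  rw [show -(s * (t ^ 2 + ∑ i, ν i ^ 2)) / 2 = -(s * t ^ 2) / 2 + -(s * ∑ i, ν i ^ 2) / 2 by ring,
    Real.exp_add]
  ring

theorem VdM_sq_smul (m : ℕ) (r : ℝ) (μ : Fin m → ℝ) :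
    r ^ m * VdM m (r • μ) ^ 2 = r ^ dof m * VdM m μ ^ 2 := by
  induction m with
  | zero => simp [VdM, dof]
  | succ m ih =>
    have e1 : μ = Fin.cons (μ 0) (Fin.tail μ) := (Fin.cons_self_tail μ).symm
    have e2 : r • μ = Fin.cons (r * μ 0) (r • Fin.tail μ) := by
      ext i
      refine Fin.cases ?_ (fun i => ?_) i <;> simp [Fin.tail]
    rw [e2]
    conv_rhs => rw [e1]
    rw [VdM_cons, VdM_cons, dof_succ]
    have e3 : ∏ j, ((r * μ 0) ^ 2 - (r • Fin.tail μ) j ^ 2) =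
        r ^ (2 * m) * ∏ j, (μ 0 ^ 2 - Fin.tail μ j ^ 2) := by
      have : ∀ j, (r * μ 0) ^ 2 - (r • Fin.tail μ) j ^ 2 =
          r ^ 2 * (μ 0 ^ 2 - Fin.tail μ j ^ 2) := by
        intro j
        simp only [Pi.smul_apply, smul_eq_mul]
        ring
      simp only [this, Finset.prod_mul_distrib, Finset.prod_const, Finset.card_univ,
        Fintype.card_fin, ← pow_mul]
    rw [e3]
    have := ih (Fin.tail μ)
    calc r ^ (m + 1) * ((r ^ (2 * m) * ∏ j, (μ 0 ^ 2 - Fin.tail μ j ^ 2)) *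
            VdM m (r • Fin.tail μ)) ^ 2
        = r ^ (4 * m + 1) * (∏ j, (μ 0 ^ 2 - Fin.tail μ j ^ 2)) ^ 2 *
            (r ^ m * VdM m (r • Fin.tail μ) ^ 2) := by ring
      _ = _ := by
        rw [this]
        ring

theorem mass_SigmaN (m : ℕ) (s : ℝ) (hs : 0 < s) :
    mass m s (SigmaN m) = ENNReal.ofReal ((Real.sqrt s)⁻¹ ^ dof m * partition m) := by
  set r := Real.sqrt s with hr
  have hr0 : 0 < r := Real.sqrt_pos.mpr hs
  have hrs : r ^ 2 = s := Real.sq_sqrt hs.le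
  have hdens : ∀ μ : Fin m → ℝ, dens m s μ = r ^ m * (r⁻¹ ^ dof m * dens m 1 (r • μ)) := by
    intro μ
    have h := VdM_sq_smul m r μ
    have he : s * ∑ j, μ j ^ 2 = 1 * ∑ j, (r • μ) j ^ 2 := by
      rw [one_mul, Finset.mul_sum]
      refine Finset.sum_congr rfl fun j _ => ?_
      simp only [Pi.smul_apply, smul_eq_mul]
      rw [mul_pow, hrs]
    rw [dens, dens, he]
    have h' : VdM m μ ^ 2 = r⁻¹ ^ dof m * (r ^ m * VdM m (r • μ) ^ 2) := by
      rw [h, ← mul_assoc, ← mul_pow, inv_mul_cancel₀ hr0.ne', one_pow, one_mul]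
    rw [h']
    ring
  have hpre : (fun μ : Fin m → ℝ => r • μ) ⁻¹' SigmaN m = SigmaN m := by
    ext μ
    simp [SigmaN, hr0]
  have hmap := Measure.map_addHaar_smul (volume : Measure (Fin m → ℝ)) hr0.ne'
  have hmeas : Measurable fun μ : Fin m → ℝ => ENNReal.ofReal (dens m 1 μ) :=
    (continuous_dens m 1).measurable.ennreal_ofReal
  have h1 : ∫⁻ μ in SigmaN m, ENNReal.ofReal (dens m 1 (r • μ)) =
      ENNReal.ofReal (r⁻¹ ^ m) * mass m 1 (SigmaN m) := by
    have := setLIntegral_map (μ := (volume : Measure (Fin m → ℝ))) (measurableSet_SigmaN m) hmeas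
      (measurable_const_smul r)
    rw [hmap, hpre] at this
    rw [← this, Measure.restrict_smul, lintegral_smul_measure, mass]
    simp [abs_of_pos hr0]
  have h2 : mass m s (SigmaN m) = ENNReal.ofReal (r ^ m * r⁻¹ ^ dof m) *
      ∫⁻ μ in SigmaN m, ENNReal.ofReal (dens m 1 (r • μ)) := by
    rw [mass, ← lintegral_const_mul' _ _ ENNReal.ofReal_ne_top]
    refine lintegral_congr fun μ => ?_
    rw [← ENNReal.ofReal_mul (by positivity), hdens, mul_assoc]
  rw [h2, h1, mass_one_SigmaN, ← ENNReal.ofReal_mul (by positivity),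
    ← ENNReal.ofReal_mul (by positivity)]
  congr 1
  have : r ^ m * r⁻¹ ^ m = 1 := by
    rw [← mul_pow, mul_inv_cancel₀ hr0.ne', one_pow]
  calc r ^ m * r⁻¹ ^ dof m * (r⁻¹ ^ m * partition m)
      = (r ^ m * r⁻¹ ^ m) * (r⁻¹ ^ dof m * partition m) := by ring
    _ = _ := by rw [this, one_mul]

theorem partition_pos (m : ℕ) : 0 < partition m :=
  Finset.prod_pos fun i _ => by
    have := Real.pi_pos
    positivity

theorem setLIntegral_fin_cons (m : ℕ) {F : (Fin (m + 1) → ℝ) → ENNReal} (hF : Measurable F)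
    (A : Set ℝ) (S : Set (Fin m → ℝ)) :
    ∫⁻ μ in {μ : Fin (m + 1) → ℝ | μ 0 ∈ A ∧ Fin.tail μ ∈ S}, F μ =
      ∫⁻ t in A, ∫⁻ ν in S, F (Fin.cons t ν) := by
  have hmp := (volume_preserving_piFinSuccAbove (fun _ : Fin (m + 1) => ℝ) 0).symm
  have h := hmp.setLIntegral_comp_preimage_emb (MeasurableEquiv.measurableEmbedding _) F
    {μ : Fin (m + 1) → ℝ | μ 0 ∈ A ∧ Fin.tail μ ∈ S}
  have hcoe : ∀ p : ℝ × (Fin m → ℝ),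
      (MeasurableEquiv.piFinSuccAbove (fun _ : Fin (m + 1) => ℝ) 0).symm p =
        (Fin.cons p.1 p.2 : Fin (m + 1) → ℝ) := by
    intro p
    simp [MeasurableEquiv.piFinSuccAbove_symm_apply]
    rfl
  have hpre : ⇑(MeasurableEquiv.piFinSuccAbove (fun _ : Fin (m + 1) => ℝ) 0).symm ⁻¹'
      {μ : Fin (m + 1) → ℝ | μ 0 ∈ A ∧ Fin.tail μ ∈ S} = A ×ˢ S := by
    ext p
    simp only [Set.mem_preimage, hcoe]
    simp
  rw [← h, hpre]
  simp only [hcoe]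
  rw [Measure.volume_eq_prod, ← Measure.prod_restrict, lintegral_prod]
  refine (hF.comp ?_).aemeasurable
  simp only [← hcoe]
  exact MeasurableEquiv.measurable _

theorem mass_mono {m : ℕ} {s : ℝ} {S T : Set (Fin m → ℝ)} (h : S ⊆ T) : mass m s S ≤ mass m s T :=
  lintegral_mono_set h

theorem measurable_ofReal_dens (m : ℕ) (s : ℝ) :
    Measurable fun μ : Fin m → ℝ => ENNReal.ofReal (dens m s μ) :=
  (continuous_dens m s).measurable.ennreal_ofReal

/-- Adding one particle well separated from the others. -/
theorem exp_mul_mass_le_mass_cons (m : ℕ) {a b : ℝ} (hab : a + 1 ≤ b) (ha : 0 ≤ a)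
    {S : Set (Fin m → ℝ)} (hS : MeasurableSet S) (hSa : ∀ ν ∈ S, ∀ i, 0 ≤ ν i ∧ ν i + 1 ≤ a) :
    ENNReal.ofReal (Real.exp (-(b ^ 2) / 2)) * mass m 1 S ≤
      mass (m + 1) 1 {μ : Fin (m + 1) → ℝ | μ 0 ∈ Set.Icc a b ∧ Fin.tail μ ∈ S} := by
  rw [mass, mass, setLIntegral_fin_cons m (measurable_ofReal_dens _ _)]
  have hpt : ∀ t ∈ Set.Icc a b, ENNReal.ofReal (Real.exp (-(b ^ 2) / 2)) *
      ∫⁻ ν in S, ENNReal.ofReal (dens m 1 ν) ≤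
      ∫⁻ ν in S, ENNReal.ofReal (dens (m + 1) 1 (Fin.cons t ν)) := by
    intro t ht
    rw [← lintegral_const_mul' _ _ ENNReal.ofReal_ne_top]
    refine setLIntegral_mono' hS fun ν hν => ?_
    rw [← ENNReal.ofReal_mul (Real.exp_nonneg _)]
    refine ENNReal.ofReal_le_ofReal ?_
    rw [dens_cons]
    refine mul_le_mul_of_nonneg_right ?_ (dens_nonneg _ _ _)
    have h1 : (1 : ℝ) ≤ ∏ j, (t ^ 2 - ν j ^ 2) ^ 2 := by
      refine Finset.one_le_prod fun j _ => ?_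
      obtain ⟨h0, h1⟩ := hSa ν hν j
      have h2 : 1 ≤ t ^ 2 - ν j ^ 2 := by nlinarith [ht.1]
      exact one_le_pow₀ h2
    have h2 : Real.exp (-(b ^ 2) / 2) ≤ Real.exp (-(1 * t ^ 2) / 2) := by
      apply Real.exp_le_exp.mpr
      have : t ^ 2 ≤ b ^ 2 := pow_le_pow_left₀ (ha.trans ht.1) ht.2 2
      linarith
    calc Real.exp (-(b ^ 2) / 2) ≤ 1 * Real.exp (-(1 * t ^ 2) / 2) := by rwa [one_mul]
      _ ≤ _ := mul_le_mul_of_nonneg_right h1 (Real.exp_nonneg _)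
  calc ENNReal.ofReal (Real.exp (-(b ^ 2) / 2)) * ∫⁻ ν in S, ENNReal.ofReal (dens m 1 ν)
      ≤ ENNReal.ofReal (Real.exp (-(b ^ 2) / 2)) * (∫⁻ ν in S, ENNReal.ofReal (dens m 1 ν)) *
          volume (Set.Icc a b) := by
        rw [Real.volume_Icc]
        refine le_mul_of_one_le_right zero_le ?_
        rw [ENNReal.one_le_ofReal]
        linarith
    _ = ∫⁻ _ in Set.Icc a b, ENNReal.ofReal (Real.exp (-(b ^ 2) / 2)) *
          ∫⁻ ν in S, ENNReal.ofReal (dens m 1 ν) := by rw [setLIntegral_const]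
    _ ≤ _ := setLIntegral_mono' measurableSet_Icc hpt

theorem mass_le_exp_mul_mass (m : ℕ) {s s' c : ℝ} {S : Set (Fin m → ℝ)} (hS : MeasurableSet S)
    (h : ∀ ν ∈ S, c ≤ (s - s') * ∑ j, ν j ^ 2) :
    mass m s S ≤ ENNReal.ofReal (Real.exp (-c / 2)) * mass m s' S := by
  rw [mass, mass, ← lintegral_const_mul' _ _ ENNReal.ofReal_ne_top]
  refine setLIntegral_mono' hS fun ν hν => ?_
  rw [← ENNReal.ofReal_mul (Real.exp_nonneg _)]
  refine ENNReal.ofReal_le_ofReal ?_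
  rw [dens, dens, mul_left_comm, ← Real.exp_add]
  refine mul_le_mul_of_nonneg_left (Real.exp_le_exp.mpr ?_) (sq_nonneg _)
  have := h ν hν
  linarith

theorem tail_mem_SigmaN {m : ℕ} {μ : Fin (m + 1) → ℝ} (h : μ ∈ SigmaN (m + 1)) :
    Fin.tail μ ∈ SigmaN m :=
  ⟨fun i j hij => h.1 i.succ j.succ (Fin.succ_lt_succ_iff.mpr hij), fun i => h.2 i.succ⟩

theorem pow_mul_exp_le (m : ℕ) {s R t : ℝ} (hs : 0 < s) (hR : 0 ≤ R) (ht : R < t) :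
    t ^ (4 * m) * Real.exp (-(s * t ^ 2) / 2) ≤
      (2 * m).factorial * (8 / s) ^ (2 * m) * Real.exp (-(s * R ^ 2) / 4) *
        Real.exp (-(s / 8) * t ^ 2) := by
  have h1 := Real.pow_div_factorial_le_exp (s * t ^ 2 / 8) (by positivity) (2 * m)
  have hf : (0 : ℝ) < (2 * m).factorial := by exact_mod_cast Nat.factorial_pos _
  rw [div_le_iff₀ hf] at h1
  have h2 : t ^ (4 * m) = (8 / s) ^ (2 * m) * (s * t ^ 2 / 8) ^ (2 * m) := by
    rw [← mul_pow, show 8 / s * (s * t ^ 2 / 8) = t ^ 2 by field_simp, ← pow_mul]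
    congr 1
    ring
  have h3 : Real.exp (-(s * t ^ 2) / 2) ≤ Real.exp (-(s * t ^ 2 / 8)) *
      (Real.exp (-(s * R ^ 2) / 4) * Real.exp (-(s / 8) * t ^ 2)) := by
    rw [← Real.exp_add, ← Real.exp_add]
    apply Real.exp_le_exp.mpr
    have : s * R ^ 2 ≤ s * t ^ 2 :=
      mul_le_mul_of_nonneg_left (pow_le_pow_left₀ hR ht.le 2) hs.le
    linarith
  calc t ^ (4 * m) * Real.exp (-(s * t ^ 2) / 2)
      ≤ ((8 / s) ^ (2 * m) * (Real.exp (s * t ^ 2 / 8) * (2 * m).factorial)) *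
        (Real.exp (-(s * t ^ 2 / 8)) *
          (Real.exp (-(s * R ^ 2) / 4) * Real.exp (-(s / 8) * t ^ 2))) := by
        rw [h2]
        gcongr
    _ = _ := by
        have : Real.exp (s * t ^ 2 / 8) * Real.exp (-(s * t ^ 2 / 8)) = 1 := by
          rw [← Real.exp_add]
          simp
        linear_combination ((8 / s) ^ (2 * m) * (2 * m).factorial *
          (Real.exp (-(s * R ^ 2) / 4) * Real.exp (-(s / 8) * t ^ 2))) * this

/-- The largest particle is unlikely to be large. -/
theorem mass_top_gt_le (m : ℕ) {s R : ℝ} (hs : 0 < s) (hR : 0 ≤ R) :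
    mass (m + 1) s {μ | μ ∈ SigmaN (m + 1) ∧ R < μ 0} ≤
      ENNReal.ofReal (4 * 64 ^ m * Real.exp (-(s * R ^ 2) / 4)) *
        mass (m + 1) s (SigmaN (m + 1)) := by
  set G : (Fin (m + 1) → ℝ) → ENNReal := fun μ =>
    ENNReal.ofReal (μ 0 ^ (4 * m) * Real.exp (-(s * μ 0 ^ 2) / 2)) *
      ENNReal.ofReal (dens m s (Fin.tail μ)) with hG
  have htail : Measurable fun μ : Fin (m + 1) → ℝ => Fin.tail μ := by
    unfold Fin.tail
    fun_prop
  have hGm : Measurable G := by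
    refine Measurable.mul ?_ ((measurable_ofReal_dens m s).comp htail)
    fun_prop
  have hmeas : MeasurableSet {μ : Fin (m + 1) → ℝ | μ ∈ SigmaN (m + 1) ∧ R < μ 0} :=
    (measurableSet_SigmaN _).inter (measurableSet_lt measurable_const (measurable_pi_apply 0))
  have h1 : mass (m + 1) s {μ | μ ∈ SigmaN (m + 1) ∧ R < μ 0} ≤
      ∫⁻ μ in {μ : Fin (m + 1) → ℝ | μ 0 ∈ Set.Ioi R ∧ Fin.tail μ ∈ SigmaN m}, G μ := by
    refine (setLIntegral_mono' hmeas (g := G) fun μ hμ => ?_).trans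
      (lintegral_mono_set fun μ hμ => ⟨hμ.2, tail_mem_SigmaN hμ.1⟩)
    have e1 : μ = Fin.cons (μ 0) (Fin.tail μ) := (Fin.cons_self_tail μ).symm
    have hpos := hμ.1.2 0
    simp only [hG]
    rw [← ENNReal.ofReal_mul (by positivity)]
    refine ENNReal.ofReal_le_ofReal ?_
    conv_lhs => rw [e1]
    rw [dens_cons]
    refine mul_le_mul_of_nonneg_right ?_ (dens_nonneg _ _ _)
    refine mul_le_mul_of_nonneg_right ?_ (Real.exp_nonneg _)
    have : μ 0 ^ (4 * m) = ∏ _j : Fin m, (μ 0) ^ 4 := by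
      rw [Finset.prod_const, Finset.card_univ, Fintype.card_fin, pow_mul]
    rw [this]
    refine Finset.prod_le_prod (fun j _ => sq_nonneg _) fun j _ => ?_
    have h1 : 0 < Fin.tail μ j := hμ.1.2 j.succ
    have h2 : Fin.tail μ j < μ 0 := hμ.1.1 0 j.succ (Fin.succ_pos j)
    have h3 : Fin.tail μ j ^ 2 ≤ μ 0 ^ 2 := pow_le_pow_left₀ h1.le h2.le 2
    calc (μ 0 ^ 2 - Fin.tail μ j ^ 2) ^ 2 ≤ (μ 0 ^ 2) ^ 2 :=
          pow_le_pow_left₀ (sub_nonneg.mpr h3) (by linarith [sq_nonneg (Fin.tail μ j)]) 2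
      _ = μ 0 ^ 4 := by ring
  rw [setLIntegral_fin_cons m hGm] at h1
  have h2 : ∫⁻ t in Set.Ioi R, ∫⁻ ν in SigmaN m, G (Fin.cons t ν) ≤
      ENNReal.ofReal ((2 * m).factorial * (8 / s) ^ (2 * m) * Real.exp (-(s * R ^ 2) / 4) *
        Real.sqrt (Real.pi / (s / 8))) * mass m s (SigmaN m) := by
    have hin : ∀ t ∈ Set.Ioi R, ∫⁻ ν in SigmaN m, G (Fin.cons t ν) ≤
        ENNReal.ofReal ((2 * m).factorial * (8 / s) ^ (2 * m) * Real.exp (-(s * R ^ 2) / 4) *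
          Real.exp (-(s / 8) * t ^ 2)) * mass m s (SigmaN m) := by
      intro t ht
      simp only [hG, Fin.cons_zero, Fin.tail_cons]
      rw [lintegral_const_mul' _ _ ENNReal.ofReal_ne_top, mass]
      exact mul_le_mul_left (ENNReal.ofReal_le_ofReal (pow_mul_exp_le m hs hR ht)) _
    refine (setLIntegral_mono' measurableSet_Ioi hin).trans ?_
    refine (setLIntegral_le_lintegral _ _).trans ?_
    rw [lintegral_mul_const _ (by fun_prop)]
    gcongr
    have hintegrable : Integrable fun t : ℝ => Real.exp (-(s / 8) * t ^ 2) :=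
      integrable_exp_neg_mul_sq (by positivity)
    rw [← ofReal_integral_eq_lintegral_ofReal (hintegrable.const_mul _)
      (ae_of_all _ fun t => by positivity), integral_const_mul, integral_gaussian]
  refine (h1.trans h2).trans (le_of_eq ?_)
  rw [mass_SigmaN m s hs, mass_SigmaN (m + 1) s hs, ← ENNReal.ofReal_mul (by positivity),
    ← ENNReal.ofReal_mul (by positivity)]
  congr 1
  have hp : partition (m + 1) = partition m * ((2 * m).factorial * Real.sqrt (Real.pi / 2)) := by
    rw [partition, Finset.prod_range_succ, ← partition]
  set r := Real.sqrt s with hr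
  have hr0 : 0 < r := Real.sqrt_pos.mpr hs
  have hrs : s = r ^ 2 := (Real.sq_sqrt hs.le).symm
  have hsq : Real.sqrt (Real.pi / (s / 8)) = 4 / r * Real.sqrt (Real.pi / 2) := by
    rw [show Real.pi / (s / 8) = (4 / r) ^ 2 * (Real.pi / 2) by
      rw [hrs]
      field_simp
      norm_num, Real.sqrt_mul (by positivity), Real.sqrt_sq (by positivity)]
  rw [hp, dof_succ, hsq]
  have h64 : (8 / s) ^ (2 * m) * (1 / r) = 64 ^ m * r⁻¹ ^ (4 * m + 1) := by
    rw [pow_succ, pow_mul, pow_mul, ← mul_assoc, ← mul_pow, one_div, hrs]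
    congr 2
    field_simp
    norm_num
  have h64' : (8 / s) ^ (2 * m) * (4 / r) = 4 * (64 ^ m * r⁻¹ ^ (4 * m + 1)) := by
    rw [← h64]
    ring
  calc _ = ((8 / s) ^ (2 * m) * (4 / r)) * ((2 * m).factorial * Real.exp (-(s * R ^ 2) / 4) *
        Real.sqrt (Real.pi / 2) * (r⁻¹ ^ dof m * partition m)) := by ring
    _ = _ := by
      rw [h64']
      ring

theorem mass_le_exp_dof_mul_mass_SigmaN (m : ℕ) {s u l : ℝ} (hs : 0 < s) (hu : 0 < u)
    {S : Set (Fin m → ℝ)} (hS : MeasurableSet S) (hSub : S ⊆ SigmaN m)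
    (h : ∀ ν ∈ S, (s - s / u) * (dof m * l) ≤ (s - s / u) * ∑ j, ν j ^ 2) :
    mass m s S ≤ ENNReal.ofReal (Real.exp (-((s - s / u) * l - Real.log u) / 2 * dof m)) *
      mass m s (SigmaN m) := by
  refine (mass_le_exp_mul_mass m hS h).trans ?_
  refine (mul_le_mul_right (mass_mono hSub) _).trans (le_of_eq ?_)
  rw [mass_SigmaN m _ (div_pos hs hu), mass_SigmaN m s hs,
    ← ENNReal.ofReal_mul (Real.exp_nonneg _), ← ENNReal.ofReal_mul (Real.exp_nonneg _)]
  congr 1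
  have hsq : (Real.sqrt (s / u))⁻¹ = Real.exp (Real.log u / 2) * (Real.sqrt s)⁻¹ := by
    rw [Real.sqrt_div hs.le, inv_div, ← Real.log_sqrt hu.le, Real.exp_log (Real.sqrt_pos.mpr hu)]
    ring
  rw [hsq, mul_pow, ← Real.exp_nat_mul, mul_assoc, ← mul_assoc, ← Real.exp_add]
  congr 2
  ring

/-- Configurations whose empirical second moment is close to its mean and whose particles are
small compared with the square root of the number of degrees of freedom. -/
def bulk (m : ℕ) (s δ η : ℝ) : Set (Fin m → ℝ) :=
  {ν | ν ∈ SigmaN m ∧ dof m * (1 / s - δ) ≤ ∑ j, ν j ^ 2 ∧ ∑ j, ν j ^ 2 ≤ dof m * (1 / s + δ) ∧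
    ∀ i, ν i ≤ η * Real.sqrt (dof m)}

theorem measurable_sum_sq (m : ℕ) : Measurable fun ν : Fin m → ℝ => ∑ j, ν j ^ 2 := by
  fun_prop

theorem measurableSet_bulk (m : ℕ) (s δ η : ℝ) : MeasurableSet (bulk m s δ η) := by
  have h : MeasurableSet {ν : Fin m → ℝ | ∀ i, ν i ≤ η * Real.sqrt (dof m)} := by
    simp only [Set.ofPred_forall]
    exact MeasurableSet.iInter fun i => measurableSet_le (measurable_pi_apply i) measurable_const
  exact (measurableSet_SigmaN m).inter ((measurableSet_le measurable_const
    (measurable_sum_sq m)).inter ((measurableSet_le (measurable_sum_sq m)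
    measurable_const).inter h))

theorem tendsto_dof_atTop : Tendsto (fun m => (dof m : ℝ)) atTop atTop := by
  refine tendsto_atTop_mono' _ ?_ (tendsto_natCast_atTop_atTop (R := ℝ))
  filter_upwards [eventually_ge_atTop 1] with m hm
  have : (1 : ℝ) ≤ m := by exact_mod_cast hm
  rw [dof_eq]
  nlinarith

theorem tendsto_exp_neg_mul_dof {c : ℝ} (hc : 0 < c) :
    Tendsto (fun m => Real.exp (-c / 2 * dof m)) atTop (nhds 0) := by
  refine Real.tendsto_exp_atBot.comp ?_
  exact tendsto_dof_atTop.const_mul_atTop_of_neg (by linarith)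

theorem tendsto_pow_mul_exp_neg_dof {c : ℝ} (hc : 0 < c) :
    Tendsto (fun m : ℕ => 4 * 64 ^ m * Real.exp (-(c * dof m))) atTop (nhds 0) := by
  have h1 : Tendsto (fun m : ℕ => (m : ℝ) * (Real.log 64 - c * (2 * m - 1))) atTop atBot := by
    refine tendsto_natCast_atTop_atTop.atTop_mul_atBot₀ ?_
    refine tendsto_atBot_add_const_left atTop (Real.log 64)
      (f := fun m : ℕ => -(c * (2 * (m : ℝ) - 1))) ?_
    refine tendsto_neg_atTop_atBot.comp ?_
    refine Tendsto.const_mul_atTop hc ?_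
    exact tendsto_atTop_add_const_right _ _
      (tendsto_natCast_atTop_atTop.const_mul_atTop (by norm_num))
  have h2 := (Real.tendsto_exp_atBot.comp h1).const_mul 4
  rw [mul_zero] at h2
  refine h2.congr fun m => ?_
  have : (64 : ℝ) ^ m = Real.exp (m * Real.log 64) := by
    rw [Real.exp_nat_mul, Real.exp_log (by norm_num)]
  rw [Function.comp_apply, this, mul_assoc, ← Real.exp_add, dof_eq]
  congr 2
  ring

theorem mass_SigmaN_le_two_mul_mass_bulk {s δ η : ℝ} (hs : 0 < s) (hδ : 0 < δ) (hη : 0 < η) :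
    ∀ᶠ m in atTop, mass m s (SigmaN m) ≤ 2 * mass m s (bulk m s δ η) := by
  set d := δ * s / 2 with hd
  have hd0 : 0 < d := by positivity
  set κ₁ := (s - s / (1 + d)) * (1 / s + δ) - Real.log (1 + d) with hκ₁
  set κ₂ := (s - s / (1 + d)⁻¹) * (1 / s - δ) - Real.log (1 + d)⁻¹ with hκ₂
  have hδs : δ * s = 2 * d := by rw [hd]; ring
  have h1 : 0 < κ₁ := by
    have hl : Real.log (1 + d) ≤ d := by
      have := Real.log_le_sub_one_of_pos (show 0 < 1 + d by linarith)
      linarith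
    have e : (s - s / (1 + d)) * (1 / s + δ) = d + d * d / (1 + d) := by
      have : (s - s / (1 + d)) * (1 / s + δ) = (1 - 1 / (1 + d)) * (1 + δ * s) := by
        field_simp
      rw [this, hδs]
      field_simp
      ring
    have : 0 < d * d / (1 + d) := by positivity
    rw [hκ₁, e]
    linarith
  have h2 : 0 < κ₂ := by
    have hl : d / (1 + d) ≤ Real.log (1 + d) := by
      have := Real.one_sub_inv_le_log_of_pos (show 0 < 1 + d by linarith)
      have e : d / (1 + d) = 1 - (1 + d)⁻¹ := by
        field_simp
        ring
      rwa [e]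
    have e : (s - s / (1 + d)⁻¹) * (1 / s - δ) = -d + 2 * d ^ 2 := by
      have : (s - s / (1 + d)⁻¹) * (1 / s - δ) = (-d) * (1 - δ * s) := by
        field_simp
        ring
      rw [this, hδs]
      ring
    have h3 : d / (1 + d) = d - d ^ 2 / (1 + d) := by
      field_simp
      ring
    have h4 : d ^ 2 / (1 + d) < 2 * d ^ 2 := by
      rw [div_lt_iff₀ (by linarith)]
      nlinarith [pow_pos hd0 2, pow_pos hd0 3]
    rw [hκ₂, e, Real.log_inv]
    linarith
  have hc3 : 0 < s * η ^ 2 / 4 := by positivity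
  have e1 := (tendsto_exp_neg_mul_dof h1).eventually_le_const (show (0 : ℝ) < 1 / 6 by norm_num)
  have e2 := (tendsto_exp_neg_mul_dof h2).eventually_le_const (show (0 : ℝ) < 1 / 6 by norm_num)
  have e3 := (tendsto_pow_mul_exp_neg_dof hc3).eventually_le_const
    (show (0 : ℝ) < 1 / 6 by norm_num)
  filter_upwards [e1, e2, e3, eventually_ge_atTop 1] with m e1 e2 e3 hm
  set q := mass m s (SigmaN m) with hq
  set C₁ : Set (Fin m → ℝ) := {ν | ν ∈ SigmaN m ∧ dof m * (1 / s + δ) < ∑ j, ν j ^ 2}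
  set C₂ : Set (Fin m → ℝ) := {ν | ν ∈ SigmaN m ∧ ∑ j, ν j ^ 2 < dof m * (1 / s - δ)}
  set C₃ : Set (Fin m → ℝ) := {ν | ν ∈ SigmaN m ∧ ∃ i, η * Real.sqrt (dof m) < ν i}
  have b1 : mass m s C₁ ≤ ENNReal.ofReal (1 / 6) * q := by
    refine (mass_le_exp_dof_mul_mass_SigmaN m (u := 1 + d) (l := 1 / s + δ) hs (by linarith)
      ((measurableSet_SigmaN m).inter (measurableSet_lt measurable_const (measurable_sum_sq m)))
      (fun ν hν => hν.1) fun ν hν => ?_).trans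
      (mul_le_mul_left (ENNReal.ofReal_le_ofReal e1) _)
    refine mul_le_mul_of_nonneg_left hν.2.le ?_
    rw [sub_nonneg]
    exact div_le_self hs.le (by linarith)
  have b2 : mass m s C₂ ≤ ENNReal.ofReal (1 / 6) * q := by
    refine (mass_le_exp_dof_mul_mass_SigmaN m (u := (1 + d)⁻¹) (l := 1 / s - δ) hs
      (by positivity)
      ((measurableSet_SigmaN m).inter (measurableSet_lt (measurable_sum_sq m) measurable_const))
      (fun ν hν => hν.1) fun ν hν => ?_).trans
      (mul_le_mul_left (ENNReal.ofReal_le_ofReal e2) _)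
    refine mul_le_mul_of_nonpos_left hν.2.le ?_
    rw [div_inv_eq_mul]
    nlinarith
  have b3 : mass m s C₃ ≤ ENNReal.ofReal (1 / 6) * q := by
    obtain ⟨k, rfl⟩ : ∃ k, m = k + 1 := ⟨m - 1, by omega⟩
    have hsub : C₃ ⊆ {μ | μ ∈ SigmaN (k + 1) ∧ η * Real.sqrt (dof (k + 1)) < μ 0} := by
      rintro ν ⟨hν, i, hi⟩
      exact ⟨hν, hi.trans_le ((SigmaN_strictAnti hν).antitone (Fin.zero_le i))⟩
    refine (mass_mono hsub).trans ((mass_top_gt_le k hs (by positivity)).trans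
      (mul_le_mul_left (ENNReal.ofReal_le_ofReal (le_trans ?_ e3)) _))
    rw [mul_pow, Real.sq_sqrt (Nat.cast_nonneg _)]
    have hpow : (64 : ℝ) ^ k ≤ 64 ^ (k + 1) := pow_le_pow_right₀ (by norm_num) (Nat.le_succ k)
    have he : -(s * (η ^ 2 * (dof (k + 1) : ℝ))) / 4 = -(s * η ^ 2 / 4 * dof (k + 1)) := by ring
    rw [he]
    gcongr
  have hcover : SigmaN m ⊆ bulk m s δ η ∪ (C₁ ∪ (C₂ ∪ C₃)) := by
    intro ν hν
    by_cases g1 : ν ∈ C₁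
    · exact Or.inr (Or.inl g1)
    by_cases g2 : ν ∈ C₂
    · exact Or.inr (Or.inr (Or.inl g2))
    by_cases g3 : ν ∈ C₃
    · exact Or.inr (Or.inr (Or.inr g3))
    refine Or.inl ⟨hν, ?_, ?_, fun i => ?_⟩
    · by_contra hc
      exact g2 ⟨hν, not_le.mp hc⟩
    · by_contra hc
      exact g1 ⟨hν, not_le.mp hc⟩
    · by_contra hc
      exact g3 ⟨hν, i, not_le.mp hc⟩
  have hle : q ≤ mass m s (bulk m s δ η) + (ENNReal.ofReal (1 / 6) * q +
      (ENNReal.ofReal (1 / 6) * q + ENNReal.ofReal (1 / 6) * q)) := by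
    refine (mass_mono hcover).trans ((lintegral_union_le _ _ _).trans ?_)
    refine add_le_add le_rfl ((lintegral_union_le _ _ _).trans (add_le_add b1 ?_))
    exact (lintegral_union_le _ _ _).trans (add_le_add b2 b3)
  have hqtop : q ≠ ⊤ := by
    rw [hq, mass_SigmaN m s hs]
    exact ENNReal.ofReal_ne_top
  have hbtop : mass m s (bulk m s δ η) ≠ ⊤ :=
    ne_top_of_le_ne_top hqtop (mass_mono fun ν hν => hν.1)
  rw [← ENNReal.ofReal_toReal hqtop, ← ENNReal.ofReal_toReal hbtop] at hle ⊢
  rw [← ENNReal.ofReal_mul (by norm_num), ← ENNReal.ofReal_add (by positivity) (by positivity),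
    ← ENNReal.ofReal_add (by positivity) (by positivity),
    ← ENNReal.ofReal_add (by positivity) (by positivity),
    ENNReal.ofReal_le_ofReal_iff (by positivity)] at hle
  rw [← ENNReal.ofReal_ofNat, ← ENNReal.ofReal_mul (by norm_num)]
  refine ENNReal.ofReal_le_ofReal ?_
  linarith

/-- Configurations obtained from `B` by adding `k` outer particles, the `r`-th one (counted from
the inside) lying in `[a r, e (r + 1)]`. -/
def shell {m : ℕ} (B : Set (Fin m → ℝ)) (a e : ℕ → ℝ) : (k : ℕ) → Set (Fin (m + k) → ℝ)
  | 0 => B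
  | k + 1 => {μ : Fin (m + k + 1) → ℝ | μ 0 ∈ Set.Icc (a k) (e (k + 1)) ∧
      (Fin.tail μ : Fin (m + k) → ℝ) ∈ shell B a e k}

theorem measurableSet_shell {m : ℕ} {B : Set (Fin m → ℝ)} (hB : MeasurableSet B) (a e : ℕ → ℝ)
    (k : ℕ) : MeasurableSet (shell B a e k) := by
  induction k with
  | zero => exact hB
  | succ k ih =>
    have htail : Measurable fun μ : Fin (m + k + 1) → ℝ => (Fin.tail μ : Fin (m + k) → ℝ) := by
      unfold Fin.tail
      fun_prop
    exact ((measurable_pi_apply 0) measurableSet_Icc).inter (htail ih)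

theorem shell_le {m : ℕ} {B : Set (Fin m → ℝ)} {a e : ℕ → ℝ} (hB : ∀ ν ∈ B, ∀ i, ν i ≤ e 0)
    {k : ℕ} (hae : ∀ r < k, e r ≤ a r) : ∀ μ ∈ shell B a e k, ∀ i, μ i ≤ e k := by
  induction k with
  | zero => exact hB
  | succ k ih =>
    intro μ hμ i
    have h0 : μ (0 : Fin (m + k + 1)) ∈ Set.Icc (a k) (e (k + 1)) := hμ.1
    refine Fin.cases (motive := fun i : Fin (m + k + 1) => μ i ≤ e (k + 1)) h0.2 (fun i => ?_) i
    have h1 := ih (fun r hr => hae r (hr.trans (Nat.lt_succ_self k))) _ hμ.2 i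
    have h2 := hae k (Nat.lt_succ_self k)
    exact h1.trans (h2.trans (h0.1.trans h0.2))

theorem shell_subset_SigmaN {m : ℕ} {B : Set (Fin m → ℝ)} {a e : ℕ → ℝ} (hBS : B ⊆ SigmaN m)
    (hB : ∀ ν ∈ B, ∀ i, ν i ≤ e 0) (he : ∀ r, 0 ≤ e r) {k : ℕ} (hae : ∀ r < k, e r + 1 ≤ a r) :
    shell B a e k ⊆ SigmaN (m + k) := by
  induction k with
  | zero => exact hBS
  | succ k ih =>
    intro μ hμ
    have hae' : ∀ r < k, e r + 1 ≤ a r := fun r hr => hae r (hr.trans (Nat.lt_succ_self k))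
    have h0 : μ (0 : Fin (m + k + 1)) ∈ Set.Icc (a k) (e (k + 1)) := hμ.1
    have htail := ih hae' hμ.2
    have hle := shell_le hB (fun r hr => (lt_add_one _).le.trans (hae' r hr)) _ hμ.2
    have hk := hae k (Nat.lt_succ_self k)
    refine ⟨fun i j hij => ?_, fun i => ?_⟩
    · revert hij
      refine Fin.cases (motive := fun i : Fin (m + k + 1) => i < j → μ j < μ i) ?_
        (fun i => ?_) i
      · refine Fin.cases (motive := fun j : Fin (m + k + 1) => 0 < j → μ j < μ 0) ?_
          (fun j _ => ?_) j
        · intro h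
          exact absurd h (lt_irrefl _)
        · have := hle j
          have h1 := h0.1
          change Fin.tail μ j < _
          linarith
      · refine Fin.cases (motive := fun j : Fin (m + k + 1) => i.succ < j → μ j < μ i.succ) ?_
          (fun j hij => ?_) j
        · intro h
          exact absurd h (Fin.not_lt_zero _)
        · exact htail.1 i j (Fin.succ_lt_succ_iff.mp hij)
    · refine Fin.cases (motive := fun i : Fin (m + k + 1) => 0 < μ i) ?_ (fun i => htail.2 i) i
      have := he k
      have h1 := h0.1
      linarith

theorem exp_mul_mass_le_mass_shell {m : ℕ} {B : Set (Fin m → ℝ)} {a e : ℕ → ℝ}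
    (hBm : MeasurableSet B) (hBS : B ⊆ SigmaN m)
    (hB : ∀ ν ∈ B, ∀ i, ν i ≤ e 0) (he : ∀ r, 0 ≤ e r) {k : ℕ} (hae : ∀ r < k, e r + 1 ≤ a r)
    (hea : ∀ r < k, a r + 1 ≤ e (r + 1)) :
    ENNReal.ofReal (Real.exp (-(∑ r ∈ Finset.range k, e (r + 1) ^ 2) / 2)) * mass m 1 B ≤
      mass (m + k) 1 (shell B a e k) := by
  induction k with
  | zero => simp [shell]
  | succ k ih =>
    have hae' : ∀ r < k, e r + 1 ≤ a r := fun r hr => hae r (hr.trans (Nat.lt_succ_self k))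
    have hea' : ∀ r < k, a r + 1 ≤ e (r + 1) :=
      fun r hr => hea r (hr.trans (Nat.lt_succ_self k))
    have hk := hae k (Nat.lt_succ_self k)
    have hak : 0 ≤ a k := by linarith [he k]
    have hle := shell_le hB (fun r hr => (lt_add_one _).le.trans (hae' r hr))
    have hsub := shell_subset_SigmaN hBS hB he hae'
    refine le_trans ?_ (exp_mul_mass_le_mass_cons (m + k) (hea k (Nat.lt_succ_self k)) hak
      (measurableSet_shell hBm a e k)
      fun ν hν i => ⟨((hsub hν).2 i).le, by linarith [hle ν hν i]⟩)
    refine le_trans (le_of_eq ?_) (mul_le_mul_right (ih hae' hea') _)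
    rw [← mul_assoc, ← ENNReal.ofReal_mul (Real.exp_nonneg _), ← Real.exp_add,
      Finset.sum_range_succ]
    congr 3
    ring

theorem sum_sq_shell {m : ℕ} {B : Set (Fin m → ℝ)} {a e : ℕ → ℝ} {lo hi : ℝ}
    (hB : ∀ ν ∈ B, lo ≤ ∑ j, ν j ^ 2 ∧ ∑ j, ν j ^ 2 ≤ hi) {k : ℕ} (ha : ∀ r < k, 0 ≤ a r) :
    ∀ μ ∈ shell B a e k, lo + ∑ r ∈ Finset.range k, a r ^ 2 ≤ ∑ j, μ j ^ 2 ∧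
      ∑ j, μ j ^ 2 ≤ hi + ∑ r ∈ Finset.range k, e (r + 1) ^ 2 := by
  induction k with
  | zero => simpa [shell] using hB
  | succ k ih =>
    intro μ hμ
    have h0 : μ (0 : Fin (m + k + 1)) ∈ Set.Icc (a k) (e (k + 1)) := hμ.1
    obtain ⟨h1, h2⟩ := ih (fun r hr => ha r (hr.trans (Nat.lt_succ_self k))) _ hμ.2
    have hak := ha k (Nat.lt_succ_self k)
    have h3 : a k ^ 2 ≤ μ (0 : Fin (m + k + 1)) ^ 2 := pow_le_pow_left₀ hak h0.1 2
    have h4 : μ (0 : Fin (m + k + 1)) ^ 2 ≤ e (k + 1) ^ 2 :=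
      pow_le_pow_left₀ (hak.trans h0.1) h0.2 2
    have h5 : ∑ j, μ j ^ 2 = μ (0 : Fin (m + k + 1)) ^ 2 +
        ∑ j : Fin (m + k), (Fin.tail μ : Fin (m + k) → ℝ) j ^ 2 :=
      Fin.sum_univ_succ (n := m + k) fun j => μ j ^ 2
    rw [h5, Finset.sum_range_succ, Finset.sum_range_succ]
    constructor <;> linarith

theorem shell_apply_mem_Icc {m : ℕ} {B : Set (Fin m → ℝ)} {a e : ℕ → ℝ} {k : ℕ} :
    ∀ μ ∈ shell B a e k, ∀ i : Fin (m + k), (i : ℕ) < k →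
      μ i ∈ Set.Icc (a (k - 1 - i)) (e (k - i)) := by
  induction k with
  | zero => intro μ _ i hi; exact absurd hi (Nat.not_lt_zero _)
  | succ k ih =>
    intro μ hμ i
    refine Fin.cases (motive := fun i : Fin (m + k + 1) => (i : ℕ) < k + 1 →
      μ i ∈ Set.Icc (a (k + 1 - 1 - i)) (e (k + 1 - i))) (fun _ => hμ.1) (fun i hi => ?_) i
    have hi' : (i : ℕ) < k := by simpa using hi
    have := ih _ hμ.2 i hi'
    have e1 : k + 1 - 1 - ((i.succ : Fin (m + k + 1)) : ℕ) = k - 1 - i := by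
      rw [Fin.val_succ]
      omega
    have e2 : k + 1 - ((i.succ : Fin (m + k + 1)) : ℕ) = k - i := by
      rw [Fin.val_succ]
      omega
    rw [e1, e2]
    exact this

theorem shell_apply_le {m : ℕ} {B : Set (Fin m → ℝ)} {a e : ℕ → ℝ}
    (hB : ∀ ν ∈ B, ∀ i, ν i ≤ e 0) {k : ℕ} :
    ∀ μ ∈ shell B a e k, ∀ i : Fin (m + k), k ≤ (i : ℕ) → μ i ≤ e 0 := by
  induction k with
  | zero => exact fun μ hμ i _ => hB μ hμ i
  | succ k ih =>
    intro μ hμ i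
    refine Fin.cases (motive := fun i : Fin (m + k + 1) => k + 1 ≤ (i : ℕ) → μ i ≤ e 0)
      (fun h => absurd h (by simp)) (fun i hi => ?_) i
    exact ih _ hμ.2 i (by simpa using hi)

theorem mass_bulk_ge {m : ℕ} {J δ η : ℝ} (hJ : 0 < J)
    (h : mass m (1 / J) (SigmaN m) ≤ 2 * mass m (1 / J) (bulk m (1 / J) δ η)) :
    ENNReal.ofReal (Real.exp (dof m / 2 * (1 - J - |1 / J - 1| * δ + Real.log J) - Real.log 2) *
      partition m) ≤ mass m 1 (bulk m (1 / J) δ η) := by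
  set c := dof m * (1 - J - |1 / J - 1| * δ) with hc
  have h1 : mass m (1 / J) (bulk m (1 / J) δ η) ≤
      ENNReal.ofReal (Real.exp (-c / 2)) * mass m 1 (bulk m (1 / J) δ η) := by
    refine mass_le_exp_mul_mass m (measurableSet_bulk _ _ _ _) fun ν hν => ?_
    have hlo := hν.2.1
    have hhi := hν.2.2.1
    rw [one_div_one_div] at hlo hhi
    have e1 : c = (1 / J - 1) * (dof m * J) - |1 / J - 1| * (dof m * δ) := by
      rw [hc]
      field_simp
    have e2 : |(1 / J - 1) * (∑ j, ν j ^ 2 - dof m * J)| ≤ |1 / J - 1| * (dof m * δ) := by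
      rw [abs_mul]
      refine mul_le_mul_of_nonneg_left ?_ (abs_nonneg _)
      rw [abs_le]
      constructor <;> linarith
    have e3 := (abs_le.mp e2).1
    rw [e1]
    linarith
  rw [mass_SigmaN m _ (by positivity)] at h
  have h2 := h.trans (mul_le_mul_right h1 2)
  have hsq : (Real.sqrt (1 / J))⁻¹ ^ dof m = Real.exp (dof m / 2 * Real.log J) := by
    rw [one_div, Real.sqrt_inv, inv_inv, show (dof m : ℝ) / 2 * Real.log J =
      dof m * (Real.log J / 2) by ring, Real.exp_nat_mul, ← Real.log_sqrt hJ.le,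
      Real.exp_log (Real.sqrt_pos.mpr hJ)]
  rw [hsq] at h2
  have h3 := mul_le_mul_right h2 (ENNReal.ofReal (Real.exp (c / 2 - Real.log 2)))
  have hp := partition_pos m
  refine le_trans (le_of_eq ?_) (h3.trans (le_of_eq ?_))
  · rw [← ENNReal.ofReal_mul (Real.exp_nonneg _), ← mul_assoc, ← Real.exp_add]
    congr 3
    rw [hc]
    ring
  · rw [← ENNReal.ofReal_ofNat, ← mul_assoc, ← mul_assoc,
      ← ENNReal.ofReal_mul (Real.exp_nonneg _), ← ENNReal.ofReal_mul (by positivity)]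
    have : Real.exp (c / 2 - Real.log 2) * 2 * Real.exp (-c / 2) = 1 := by
      rw [Real.exp_sub, Real.exp_log two_pos, div_mul_cancel₀ _ two_ne_zero, ← Real.exp_add,
        show c / 2 + -c / 2 = 0 by ring, Real.exp_zero]
    rw [this, ENNReal.ofReal_one, one_mul]

theorem tendsto_log_two_mul_factorial_div_sq :
    Tendsto (fun n : ℕ => Real.log ((2 * n).factorial * Real.sqrt (Real.pi / 2)) / (n : ℝ) ^ 2)
      atTop (nhds 0) := by
  have hN : Tendsto (fun n : ℕ => (n : ℝ)) atTop atTop := tendsto_natCast_atTop_atTop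
  have h1 : Tendsto (fun n : ℕ => 4 * (Real.log (2 * n) / (2 * (n : ℝ)))) atTop (nhds 0) := by
    have h := (Real.isLittleO_log_id_atTop.tendsto_div_nhds_zero).comp
      (hN.const_mul_atTop (show (0 : ℝ) < 2 by norm_num))
    simpa using h.const_mul 4
  have h2 : Tendsto (fun n : ℕ => Real.log ((2 * n).factorial) / (n : ℝ) ^ 2) atTop (nhds 0) := by
    refine squeeze_zero' (Eventually.of_forall fun n => ?_) ?_ h1
    · refine div_nonneg (Real.log_nonneg ?_) (sq_nonneg _)
      exact_mod_cast Nat.one_le_iff_ne_zero.mpr (Nat.factorial_ne_zero _)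
    · filter_upwards [eventually_ge_atTop 1] with n hn
      have hn' : (0 : ℝ) < n := by exact_mod_cast hn
      have hf : ((2 * n).factorial : ℝ) ≤ (2 * n : ℝ) ^ (2 * n) := by
        exact_mod_cast Nat.factorial_le_pow (2 * n)
      have hl := Real.log_le_log (by exact_mod_cast Nat.factorial_pos _) hf
      rw [Real.log_pow] at hl
      rw [div_le_iff₀ (by positivity)]
      refine hl.trans (le_of_eq ?_)
      push_cast
      field_simp
      ring
  have h3 : Tendsto (fun n : ℕ => Real.log (Real.sqrt (Real.pi / 2)) / (n : ℝ) ^ 2)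
      atTop (nhds 0) :=
    ((tendsto_pow_atTop (by norm_num)).comp hN).const_div_atTop _
  have h4 := h2.add h3
  rw [add_zero] at h4
  refine h4.congr fun n => ?_
  have hpi := Real.pi_pos
  rw [Real.log_mul (by positivity) (by positivity), add_div]

theorem tendsto_shift_div (i k : ℕ) :
    Tendsto (fun m : ℕ => ((m + i : ℕ) : ℝ) / ((m + k : ℕ) : ℝ)) atTop (nhds 1) := by
  have hN : Tendsto (fun m : ℕ => ((m + k : ℕ) : ℝ)) atTop atTop :=
    tendsto_natCast_atTop_atTop.comp (tendsto_add_atTop_nat k)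
  have h := (tendsto_const_nhds (x := (1 : ℝ))).add
    (hN.const_div_atTop ((i : ℝ) - k))
  rw [add_zero] at h
  refine h.congr' ?_
  filter_upwards [eventually_ge_atTop 1] with m hm
  have : (0 : ℝ) < m := by exact_mod_cast hm
  have h2 : (0 : ℝ) < ((m + k : ℕ) : ℝ) := by
    push_cast
    positivity
  rw [eq_div_iff h2.ne', add_mul, div_mul_cancel₀ _ h2.ne']
  push_cast
  ring

theorem tendsto_log_partition_sub (k : ℕ) :
    Tendsto (fun m : ℕ => (Real.log (partition (m + k)) - Real.log (partition m)) /
      ((m + k : ℕ) : ℝ) ^ 2) atTop (nhds 0) := by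
  have hpart : ∀ m : ℕ, Real.log (partition (m + k)) - Real.log (partition m) =
      ∑ i ∈ Finset.range k,
        Real.log ((2 * (m + i)).factorial * Real.sqrt (Real.pi / 2)) := by
    intro m
    have hpi := Real.pi_pos
    rw [partition, Finset.prod_range_add, ← partition, Real.log_mul (partition_pos m).ne'
      (Finset.prod_pos fun i _ => by positivity).ne',
      Real.log_prod fun i _ => by positivity]
    ring
  simp only [hpart, Finset.sum_div]
  suffices h : ∀ i ∈ Finset.range k, Tendsto (fun m : ℕ =>
      Real.log ((2 * (m + i)).factorial * Real.sqrt (Real.pi / 2)) / ((m + k : ℕ) : ℝ) ^ 2)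
      atTop (nhds 0) by
    simpa using tendsto_finsetSum _ h
  intro i _
  have h1 := (tendsto_log_two_mul_factorial_div_sq.comp (tendsto_add_atTop_nat i)).mul
    ((tendsto_shift_div i k).pow 2)
  rw [zero_mul] at h1
  refine h1.congr' ?_
  filter_upwards [eventually_ge_atTop 1] with m hm
  have : (0 : ℝ) < m := by exact_mod_cast hm
  have h2 : (0 : ℝ) < ((m + i : ℕ) : ℝ) := by
    push_cast
    positivity
  simp only [Function.comp_apply]
  rw [div_pow, div_mul_div_cancel₀ (by positivity)]

theorem tendsto_dof_div_sq (i k : ℕ) :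
    Tendsto (fun m : ℕ => (dof (m + i) : ℝ) / ((m + k : ℕ) : ℝ) ^ 2) atTop (nhds 2) := by
  have hN : Tendsto (fun m : ℕ => ((m + k : ℕ) : ℝ)) atTop atTop :=
    tendsto_natCast_atTop_atTop.comp (tendsto_add_atTop_nat k)
  have h := (tendsto_shift_div i k).mul (((tendsto_shift_div i k).const_mul 2).sub
    (hN.const_div_atTop 1))
  norm_num at h
  refine h.congr fun m => ?_
  rw [dof_eq, div_eq_mul_inv _ (_ ^ 2), ← inv_pow]
  push_cast
  ring

theorem tendsto_exponent (k : ℕ) (T A : ℝ) :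
    Tendsto (fun m : ℕ => (-(dof (m + k) * T) / 2 + (dof m / 2 * A - Real.log 2) -
      (Real.log (partition (m + k)) - Real.log (partition m))) / ((m + k : ℕ) : ℝ) ^ 2)
      atTop (nhds (-T + A)) := by
  have hN : Tendsto (fun m : ℕ => ((m + k : ℕ) : ℝ)) atTop atTop :=
    tendsto_natCast_atTop_atTop.comp (tendsto_add_atTop_nat k)
  have h3 : Tendsto (fun m : ℕ => Real.log 2 / ((m + k : ℕ) : ℝ) ^ 2) atTop (nhds 0) :=
    ((tendsto_pow_atTop (by norm_num)).comp hN).const_div_atTop _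
  have h := ((((tendsto_dof_div_sq k k).mul_const (-T / 2)).add
    ((tendsto_dof_div_sq 0 k).mul_const (A / 2))).sub h3).sub (tendsto_log_partition_sub k)
  have e : 2 * (-T / 2) + 2 * (A / 2) - 0 - 0 = -T + A := by ring
  rw [e] at h
  refine h.congr fun m => ?_
  rw [add_zero]
  ring

theorem tendsto_dof_div_dof (k : ℕ) :
    Tendsto (fun m : ℕ => (dof m : ℝ) / dof (m + k)) atTop (nhds 1) := by
  have h := (tendsto_dof_div_sq 0 k).div (tendsto_dof_div_sq k k) two_ne_zero
  rw [div_self two_ne_zero] at h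
  refine h.congr' ?_
  filter_upwards [eventually_ge_atTop 1] with m hm
  have : (0 : ℝ) < ((m + k : ℕ) : ℝ) := by exact_mod_cast (by omega : 0 < m + k)
  exact div_div_div_cancel_right₀ (by positivity) _ _

theorem dof_mono : Monotone dof := fun m k h => Nat.choose_le_choose 2 (by omega)

theorem eventually_exists_shell_mass_ge (k : ℕ) {z : ℕ → ℝ} (hz : ∀ r, 0 ≤ z r) (hz0 : z 0 = 0)
    (hmono : ∀ r < k, z r ≤ z (r + 1)) {J δ η U c : ℝ} (hJ : 0 < J) (hδ : 0 < δ) (hη : 0 < η)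
    (hU : ∑ r ∈ Finset.range k, (z (r + 1) + (2 * (r + 1) + 1) * η) ^ 2 ≤ U)
    (hc : c < -U + (1 - J - |1 / J - 1| * δ + Real.log J)) :
    ∀ᶠ m : ℕ in atTop, ∃ S : Set (Fin (m + k) → ℝ), MeasurableSet S ∧ S ⊆ SigmaN (m + k) ∧
      (∀ μ ∈ S, dof (m + k) * (J - 2 * δ + ∑ r ∈ Finset.range k, z (r + 1) ^ 2) ≤ ∑ j, μ j ^ 2 ∧
        ∑ j, μ j ^ 2 ≤ dof (m + k) * (J + δ + U) ∧
        (∀ i : Fin (m + k), (i : ℕ) < k → Real.sqrt (dof (m + k)) * z (k - i) ≤ μ i ∧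
          μ i ≤ Real.sqrt (dof (m + k)) * (z (k - i) + (2 * k + 1) * η)) ∧
        ∀ i : Fin (m + k), k ≤ (i : ℕ) → μ i ≤ Real.sqrt (dof (m + k)) * η) ∧
      ENNReal.ofReal (partition (m + k) * Real.exp (((m + k : ℕ) : ℝ) ^ 2 * c)) ≤
        mass (m + k) 1 S := by
  have hdof : Tendsto (fun m : ℕ => (dof (m + k) : ℝ)) atTop atTop :=
    tendsto_dof_atTop.comp (tendsto_add_atTop_nat k)
  have hlarge : ∀ᶠ m : ℕ in atTop, 1 ≤ Real.sqrt (dof (m + k)) * η :=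
    ((Real.tendsto_sqrt_atTop.comp hdof).atTop_mul_const hη).eventually_ge_atTop 1
  have hratio : ∀ᶠ m : ℕ in atTop, J - 2 * δ < (dof m : ℝ) / dof (m + k) * (J - δ) :=
    ((tendsto_dof_div_dof k).mul_const (J - δ)).eventually_const_lt (by linarith)
  filter_upwards [hlarge, hratio, hdof.eventually_gt_atTop 0,
    (tendsto_exponent k U (1 - J - |1 / J - 1| * δ + Real.log J)).eventually_const_lt hc,
    mass_SigmaN_le_two_mul_mass_bulk (one_div_pos.mpr hJ) hδ hη, eventually_ge_atTop 1] with
    m hlarge hratio hN hexp hbulk hm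
  set N : ℝ := (dof (m + k) : ℝ) with hNdef
  set w := Real.sqrt N with hw
  have hw0 : 0 ≤ w := Real.sqrt_nonneg _
  have hw2 : w ^ 2 = N := Real.sq_sqrt hN.le
  have hmN : (dof m : ℝ) ≤ N := Nat.cast_le.mpr (dof_mono (Nat.le_add_right m k))
  set e : ℕ → ℝ := fun r => w * (z r + (2 * r + 1) * η) with he
  set a : ℕ → ℝ := fun r => w * (z (r + 1) + (2 * r + 2) * η) with ha
  have he0 : ∀ r, 0 ≤ e r := fun r =>
    mul_nonneg hw0 (add_nonneg (hz r) (by positivity))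
  have ha0 : ∀ r, 0 ≤ a r := fun r =>
    mul_nonneg hw0 (add_nonneg (hz _) (by positivity))
  have hae : ∀ r < k, e r + 1 ≤ a r := fun r hr => by
    have := mul_le_mul_of_nonneg_left (hmono r hr) hw0
    simp only [he, ha]
    linarith
  have hea : ∀ r < k, a r + 1 ≤ e (r + 1) := fun r hr => by
    simp only [he, ha]
    push_cast
    linarith
  set B := bulk m (1 / J) δ η with hBdef
  have hB : ∀ ν ∈ B, ∀ i, ν i ≤ e 0 := fun ν hν i => by
    refine (hν.2.2.2 i).trans ?_
    have := mul_le_mul_of_nonneg_left (Real.sqrt_le_sqrt hmN) hη.le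
    simp only [he, hz0]
    push_cast
    linarith
  have hBS : B ⊆ SigmaN m := fun ν hν => hν.1
  have hBsq : ∀ ν ∈ B, N * (J - 2 * δ) ≤ ∑ j, ν j ^ 2 ∧ ∑ j, ν j ^ 2 ≤ N * (J + δ) := by
    intro ν hν
    have hlo := hν.2.1
    have hhi := hν.2.2.1
    rw [one_div_one_div] at hlo hhi
    refine ⟨le_trans ?_ hlo, hhi.trans (mul_le_mul_of_nonneg_right hmN (by positivity))⟩
    rw [div_mul_eq_mul_div, lt_div_iff₀ hN] at hratio
    linarith
  have hBm : MeasurableSet B := measurableSet_bulk _ _ _ _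
  have hesum : ∑ r ∈ Finset.range k, e (r + 1) ^ 2 ≤ N * U := by
    refine le_trans (le_of_eq ?_) (mul_le_mul_of_nonneg_left hU hN.le)
    rw [Finset.mul_sum]
    refine Finset.sum_congr rfl fun r _ => ?_
    simp only [he]
    rw [mul_pow, hw2]
    push_cast
    ring
  have hasum : N * ∑ r ∈ Finset.range k, z (r + 1) ^ 2 ≤ ∑ r ∈ Finset.range k, a r ^ 2 := by
    rw [Finset.mul_sum]
    refine Finset.sum_le_sum fun r _ => ?_
    rw [← hw2, ← mul_pow]
    refine pow_le_pow_left₀ (mul_nonneg hw0 (hz _)) (mul_le_mul_of_nonneg_left ?_ hw0) 2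
    have : 0 ≤ (2 * (r : ℝ) + 2) * η := by positivity
    linarith
  refine ⟨shell B a e k, measurableSet_shell hBm a e k, shell_subset_SigmaN hBS hB he0 hae,
    fun μ hμ => ⟨?_, ?_, fun i hi => ?_, fun i hi => ?_⟩, ?_⟩
  · have := (sum_sq_shell (lo := N * (J - 2 * δ)) hBsq (fun r _ => ha0 r) μ hμ).1
    linarith
  · have := (sum_sq_shell (lo := N * (J - 2 * δ)) hBsq (fun r _ => ha0 r) μ hμ).2
    linarith
  · obtain ⟨h1, h2⟩ := shell_apply_mem_Icc μ hμ i hi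
    refine ⟨le_trans ?_ h1, h2.trans ?_⟩
    · simp only [ha]
      rw [show k - 1 - (i : ℕ) + 1 = k - i by omega]
      refine mul_le_mul_of_nonneg_left ?_ hw0
      have : 0 ≤ (2 * ((k - 1 - (i : ℕ) : ℕ) : ℝ) + 2) * η := by positivity
      linarith
    · simp only [he]
      gcongr
      omega
  · refine (shell_apply_le hB μ hμ i hi).trans (le_of_eq ?_)
    simp [he, hz0]
  · have hpk := partition_pos (m + k)
    have hp := partition_pos m
    refine le_trans ?_ ((mul_le_mul_right (mass_bulk_ge hJ hbulk) _).trans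
      (exp_mul_mass_le_mass_shell hBm hBS hB he0 hae hea))
    rw [← ENNReal.ofReal_mul (Real.exp_nonneg _)]
    refine ENNReal.ofReal_le_ofReal ?_
    have hM : (0 : ℝ) < ((m + k : ℕ) : ℝ) ^ 2 := by
      have : (0 : ℝ) < ((m + k : ℕ) : ℝ) := by exact_mod_cast (by omega : 0 < m + k)
      positivity
    rw [lt_div_iff₀ hM] at hexp
    nth_rewrite 1 [← Real.exp_log hpk]
    nth_rewrite 1 [← Real.exp_log hp]
    rw [← Real.exp_add, ← Real.exp_add, ← Real.exp_add, Real.exp_le_exp]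
    linarith

theorem antitone_succ_of_mem_setX {x : ℕ →ᵇ ℝ} (hx : x ∈ setX) : Antitone fun j => x (j + 1) :=
  antitone_nat_of_succ_le fun j => (hx.1 (j + 1) (Nat.le_add_left 1 j)).2

theorem succ_nonneg_of_mem_setX {x : ℕ →ᵇ ℝ} (hx : x ∈ setX) (j : ℕ) : 0 ≤ x (j + 1) :=
  (hx.1 (j + 1) (Nat.le_add_left 1 j)).1.trans (hx.1 (j + 1) (Nat.le_add_left 1 j)).2

theorem eventually_exists_mass_ge {x : ℕ →ᵇ ℝ} (hx : x ∈ setX) (hJ : 0 < Jfun x) {ε θ : ℝ}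
    (hε : 0 < ε) (hθ : 0 < θ) :
    ∀ᶠ m : ℕ in atTop, ∃ S : Set (Fin m → ℝ), MeasurableSet S ∧ S ⊆ SigmaN m ∧
      (∀ μ ∈ S, |(dof m : ℝ)⁻¹ * ∑ j, μ j ^ 2 - x 0| ≤ ε / 2 ∧
        ∀ j : Fin m, |(Real.sqrt (dof m))⁻¹ * μ j - x (j + 1)| ≤ ε / 2) ∧
      (∀ j, m ≤ j → |x (j + 1)| ≤ ε / 2) ∧
      ENNReal.ofReal (partition m * Real.exp ((m : ℝ) ^ 2 *
        (-(x 0 - 1 - Real.log (Jfun x)) - θ))) ≤ mass m 1 S := by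
  set J := Jfun x with hJdef
  set g : ℕ → ℝ := fun j => x (j + 1) with hg
  have hanti : Antitone g := antitone_succ_of_mem_setX hx
  have hnn : ∀ j, 0 ≤ g j := succ_nonneg_of_mem_setX hx
  have hsum : Summable fun j => g j ^ 2 := hx.2.1
  have htsum : ∑' j, g j ^ 2 = x 0 - J := by
    rw [hJdef, Jfun]
    ring
  obtain ⟨τ, hτ, hτε, hτθ⟩ : ∃ τ : ℝ, 0 < τ ∧ τ ≤ ε / 4 ∧ τ ≤ θ / 4 :=
    ⟨min (ε / 4) (θ / 4), lt_min (by positivity) (by positivity), min_le_left _ _,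
      min_le_right _ _⟩
  obtain ⟨δ, hδ, hδε, hδθ⟩ : ∃ δ : ℝ, 0 < δ ∧ δ ≤ ε / 8 ∧ |1 / J - 1| * δ ≤ θ / 4 := by
    refine ⟨min (ε / 8) (θ / 4 / (|1 / J - 1| + 1)), lt_min (by positivity) (by positivity),
      min_le_left _ _, ?_⟩
    calc |1 / J - 1| * min (ε / 8) (θ / 4 / (|1 / J - 1| + 1))
        ≤ (|1 / J - 1| + 1) * (θ / 4 / (|1 / J - 1| + 1)) :=
          mul_le_mul (by linarith) (min_le_right _ _) (by positivity) (by positivity)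
      _ = θ / 4 := mul_div_cancel₀ _ (by positivity)
  obtain ⟨k, hkT, hk⟩ : ∃ k, x 0 - J - τ < ∑ j ∈ Finset.range k, g j ^ 2 ∧ g k ≤ ε / 2 := by
    have h1 := hsum.hasSum.tendsto_sum_nat.eventually_const_lt
      (show x 0 - J - τ < ∑' j, g j ^ 2 by linarith)
    have h2 := hsum.tendsto_atTop_zero.eventually_lt_const
      (show 0 < (ε / 2) ^ 2 by positivity)
    obtain ⟨k, hk1, hk2⟩ := (h1.and h2).exists
    exact ⟨k, hk1, (lt_of_pow_lt_pow_left₀ 2 (by positivity) hk2).le⟩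
  set T := ∑ j ∈ Finset.range k, g j ^ 2 with hT
  have hTle : T ≤ x 0 - J := htsum ▸ hsum.sum_le_tsum _ fun j _ => sq_nonneg _
  set z : ℕ → ℝ := fun r => if r = 0 then 0 else g (k - r) with hzdef
  have hzs : ∀ r, z (r + 1) = g (k - 1 - r) := fun r => by
    simp only [hzdef, Nat.succ_ne_zero, if_false]
    congr 1
    omega
  have hz : ∀ r, 0 ≤ z r := fun r => by
    simp only [hzdef]
    split_ifs
    exacts [le_rfl, hnn _]
  have hmono : ∀ r < k, z r ≤ z (r + 1) := fun r _ => by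
    simp only [hzdef, Nat.succ_ne_zero, if_false]
    split_ifs
    exacts [hnn _, hanti (by omega)]
  have hzT : ∑ r ∈ Finset.range k, z (r + 1) ^ 2 = T := by
    simp only [hzs]
    exact Finset.sum_range_reflect (fun j => g j ^ 2) k
  obtain ⟨η, hη, hηε, hU⟩ : ∃ η : ℝ, 0 < η ∧ (2 * k + 1) * η < ε / 2 ∧
      ∑ r ∈ Finset.range k, (z (r + 1) + (2 * (r + 1) + 1) * η) ^ 2 < T + τ := by
    have h1 : Continuous fun η : ℝ => (2 * (k : ℝ) + 1) * η := by fun_prop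
    have h2 : Continuous fun η : ℝ =>
        ∑ r ∈ Finset.range k, (z (r + 1) + (2 * ((r : ℝ) + 1) + 1) * η) ^ 2 := by fun_prop
    have h1' := (h1.tendsto 0).eventually_lt_const (show _ < ε / 2 by simpa using hε)
    have h2' := (h2.tendsto 0).eventually_lt_const (show _ < T + τ by simp [hzT, hτ])
    obtain ⟨η, ⟨h1, h2⟩, h3⟩ :=
      (((h1'.and h2').filter_mono nhdsWithin_le_nhds).and
        (self_mem_nhdsWithin (s := Set.Ioi (0 : ℝ)))).exists
    exact ⟨η, h3, h1, h2⟩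
  have hηε' : η ≤ ε / 2 := by
    have : 0 ≤ 2 * (k : ℝ) * η := by positivity
    linarith
  have hmain := eventually_exists_shell_mass_ge k hz (by simp [hzdef]) hmono hJ hδ hη hU.le
    (c := -(x 0 - 1 - Real.log J) - θ) (by linarith)
  rw [← map_add_atTop_eq_nat k, eventually_map]
  filter_upwards [hmain, eventually_ge_atTop 1] with m ⟨S, hSm, hSS, hS, hmass⟩ hm
  have hN : (0 : ℝ) < dof (m + k) := by
    exact_mod_cast Nat.choose_pos (by omega)
  have hw : 0 < Real.sqrt (dof (m + k)) := Real.sqrt_pos.mpr hN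
  refine ⟨S, hSm, hSS, fun μ hμ => ?_, fun j hj => ?_, hmass⟩
  · obtain ⟨hlo, hhi, hout, hin⟩ := hS μ hμ
    rw [hzT] at hlo
    refine ⟨?_, fun j => ?_⟩
    · rw [← le_inv_mul_iff₀ hN] at hlo
      rw [← inv_mul_le_iff₀ hN] at hhi
      rw [abs_le]
      constructor <;> linarith
    · rcases lt_or_ge (j : ℕ) k with hj | hj
      · obtain ⟨h1, h2⟩ := hout j hj
        have hzj : z (k - j) = x (j + 1) := by
          simp only [hzdef]
          rw [if_neg (by omega), Nat.sub_sub_self hj.le]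
        rw [hzj, ← le_inv_mul_iff₀ hw] at h1
        rw [hzj, ← inv_mul_le_iff₀ hw] at h2
        rw [abs_le]
        constructor <;> linarith
      · have h1 := hin j hj
        rw [← inv_mul_le_iff₀ hw] at h1
        have h2 : 0 ≤ (Real.sqrt (dof (m + k)))⁻¹ * μ j :=
          mul_nonneg (inv_nonneg.mpr hw.le) ((hSS hμ).2 j).le
        have h3 : x (j + 1) ≤ ε / 2 := (hanti hj).trans hk
        have h4 : 0 ≤ x (j + 1) := hnn j
        rw [abs_le]
        constructor <;> linarith
  · rw [abs_of_nonneg (hnn j)]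
    exact (hanti (by omega : k ≤ j)).trans hk

theorem Zn_two_mul (m : ℕ) : Zn (2 * m) = partition (2 * m / 2) := by
  rw [Zn, partition, Finset.prod_mul_distrib, mul_comm, Finset.prod_const, Finset.card_range,
    Real.sqrt_eq_rpow, ← Real.rpow_natCast, ← Real.rpow_mul (by positivity)]
  congr 2
  rw [Nat.mul_div_cancel_left m two_pos]
  push_cast
  ring

theorem Pn_two_mul_apply (m : ℕ) {S : Set (Fin (2 * m / 2) → ℝ)} (hS : MeasurableSet S) :
    Pn (2 * m) S = ENNReal.ofReal (partition (2 * m / 2))⁻¹ *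
      mass (2 * m / 2) 1 (S ∩ SigmaN (2 * m / 2)) := by
  rw [Pn, withDensity_apply _ hS, Measure.restrict_restrict hS, mass,
    ← lintegral_const_mul _ (measurable_ofReal_dens _ _)]
  refine lintegral_congr fun μ => ?_
  rw [← ENNReal.ofReal_mul (inv_nonneg.mpr (partition_pos _).le), Zn_two_mul, dens, one_mul,
    mul_assoc]

theorem Pn_two_mul_univ (m : ℕ) : Pn (2 * m) Set.univ = 1 := by
  have hp := partition_pos (2 * m / 2)
  rw [Pn_two_mul_apply m MeasurableSet.univ, Set.univ_inter, mass_one_SigmaN,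
    ← ENNReal.ofReal_mul (inv_nonneg.mpr hp.le), inv_mul_cancel₀ hp.ne', ENNReal.ofReal_one]

theorem dist_gamma_le {γ : (n : ℕ) → (Fin (n / 2) → ℝ) → (ℕ →ᵇ ℝ)} (hγ : IsGammaN γ) {m : ℕ}
    (hm : 0 < m) {x : ℕ →ᵇ ℝ} {ρ : ℝ} (hρ : 0 ≤ ρ) {μ : Fin (2 * m / 2) → ℝ}
    (hμ : μ ∈ SigmaN (2 * m / 2))
    (h0 : |((2 * m).choose 2 : ℝ)⁻¹ * ∑ j, μ j ^ 2 - x 0| ≤ ρ)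
    (h1 : ∀ j : Fin (2 * m / 2), |(Real.sqrt ((2 * m).choose 2))⁻¹ * μ j - x (j + 1)| ≤ ρ)
    (h2 : ∀ j, 2 * m / 2 ≤ j → |x (j + 1)| ≤ ρ) : dist (γ (2 * m) μ) x ≤ ρ := by
  obtain ⟨-, hγ0, hγ1, hγ2⟩ := hγ (2 * m) (even_two_mul m) (by omega) μ hμ
  rw [BoundedContinuousFunction.dist_le hρ]
  rintro (_ | j)
  · rwa [Real.dist_eq, hγ0]
  · rw [Real.dist_eq]
    rcases lt_or_ge j (2 * m / 2) with hj | hj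
    · rw [hγ1 ⟨j, hj⟩]
      exact h1 ⟨j, hj⟩
    · rw [hγ2 (j + 1) (by omega), zero_sub, abs_neg]
      exact h2 j hj

theorem stmt12 (γ : (n : ℕ) → (Fin (n / 2) → ℝ) → (ℕ →ᵇ ℝ)) (hγ : IsGammaN γ)
    (x : ℕ →ᵇ ℝ) (hx : x ∈ setX) (ε : ℝ) (hε0 : 0 < ε) (hε1 : ε < 1) :
    -(Ifun x) ≤ Filter.liminf (fun m : ℕ =>
      (((4 / (2 * m : ℝ) ^ 2) *
        Real.log ((Pn (2 * m) {μ | dist (γ (2 * m) μ) x < ε}).toReal) : ℝ) : EReal))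
      Filter.atTop := by
  by_cases hJ : 0 < Jfun x
  swap
  · simp [Ifun, hJ]
  rw [Ifun, if_pos hJ, ← EReal.coe_neg]
  refine le_of_forall_lt fun c hc => ?_
  obtain ⟨r, hcr, hr⟩ := EReal.lt_iff_exists_real_btwn.mp hc
  refine hcr.trans_le (le_liminf_of_le (by isBoundedDefault) ?_)
  rw [EReal.coe_lt_coe_iff] at hr
  have hmain := eventually_exists_mass_ge hx hJ hε0 (sub_pos.mpr hr)
  rw [sub_sub_cancel] at hmain
  have hhalf : Tendsto (fun m : ℕ => 2 * m / 2) atTop atTop :=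
    tendsto_id.congr fun m => (Nat.mul_div_cancel_left m two_pos).symm
  filter_upwards [hhalf.eventually hmain, eventually_gt_atTop 0] with
    m ⟨S, hSm, hSS, hS, htail, hmass⟩ hm
  rw [EReal.coe_le_coe_iff]
  have hdof : dof (2 * m / 2) = (2 * m).choose 2 := by
    rw [dof, Nat.mul_div_cancel_left m two_pos]
  rw [hdof] at hS
  have hsub : S ⊆ {μ | dist (γ (2 * m) μ) x < ε} := fun μ hμ =>
    (dist_gamma_le hγ hm (half_pos hε0).le (hSS hμ) (hS μ hμ).1 (hS μ hμ).2 htail).trans_lt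
      (half_lt_self hε0)
  have hp := partition_pos (2 * m / 2)
  have hlow : ENNReal.ofReal (Real.exp ((m : ℝ) ^ 2 * r)) ≤
      Pn (2 * m) {μ | dist (γ (2 * m) μ) x < ε} := by
    refine le_trans ?_ (measure_mono hsub)
    rw [Pn_two_mul_apply m hSm, Set.inter_eq_left.mpr hSS]
    refine le_trans (le_of_eq ?_) (mul_le_mul_right hmass _)
    rw [← ENNReal.ofReal_mul (inv_nonneg.mpr hp.le), inv_mul_cancel_left₀ hp.ne',
      Nat.mul_div_cancel_left m two_pos]
  have hfin : Pn (2 * m) {μ | dist (γ (2 * m) μ) x < ε} ≠ ⊤ :=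
    ((measure_mono (Set.subset_univ _)).trans_lt
      ((Pn_two_mul_univ m).trans_lt ENNReal.one_lt_top)).ne
  have hlog := Real.log_le_log (Real.exp_pos _) ((ENNReal.ofReal_le_iff_le_toReal hfin).mp hlow)
  rw [Real.log_exp] at hlog
  have hm' : (0 : ℝ) < m := Nat.cast_pos.mpr hm
  calc r = 4 / (2 * m : ℝ) ^ 2 * ((m : ℝ) ^ 2 * r) := by
        field_simp
        norm_num
    _ ≤ _ := mul_le_mul_of_nonneg_left hlog (by positivity)
end
end

section
/- For every t ∈ ℝ, the level set A_t = {x = (x_j)_{j=0}^∞ ∈ X : x_0 ≤ t} is a compact subset of the metric space (X,d). -/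
open MeasureTheory BoundedContinuousFunction Filter

noncomputable section

/-- Membership in `X` in terms of the partial sums of `Σ x_j²`. -/
theorem memX_iff_sum_range_le (x : ℕ →ᵇ ℝ) :
    memX x ↔ (∀ j : ℕ, 1 ≤ j → 0 ≤ x (j + 1) ∧ x (j + 1) ≤ x j) ∧
      ∀ n : ℕ, ∑ j ∈ Finset.range n, (x (j + 1)) ^ 2 ≤ x 0 := by
  refine and_congr_right fun _ => ⟨fun ⟨hs, hle⟩ n => ?_, fun h => ⟨?_, ?_⟩⟩
  · exact (hs.sum_le_tsum _ fun _ _ => sq_nonneg _).trans hle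
  · exact summable_of_sum_range_le (fun _ => sq_nonneg _) h
  · exact Real.tsum_le_of_sum_range_le (fun _ => sq_nonneg _) h

theorem memX.nonneg {x : ℕ →ᵇ ℝ} (hx : memX x) (n : ℕ) : 0 ≤ x n := by
  rcases n with _ | n
  · simpa using ((memX_iff_sum_range_le x).1 hx).2 0
  · exact (hx.1 (n + 1) (by omega)).1.trans (hx.1 (n + 1) (by omega)).2

/-- The coordinates of a point of `X` decay at the uniform rate `x_n² ≤ x_0 / n`. -/
theorem memX.mul_sq_le {x : ℕ →ᵇ ℝ} (hx : memX x) (n : ℕ) : n * (x n) ^ 2 ≤ x 0 := by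
  have hanti : AntitoneOn x (Set.Ici 1) :=
    antitoneOn_of_succ_le Set.ordConnected_Ici fun j _ hj _ => (hx.1 j hj).2
  calc n * (x n) ^ 2 = ∑ _j ∈ Finset.range n, (x n) ^ 2 := by simp
    _ ≤ ∑ j ∈ Finset.range n, (x (j + 1)) ^ 2 := by
        refine Finset.sum_le_sum fun j hj => ?_
        have hj : j + 1 ≤ n := Finset.mem_range.1 hj
        exact pow_le_pow_left₀ (hx.nonneg n)
          (hanti (Set.mem_Ici.2 (by omega)) (Set.mem_Ici.2 (by omega)) hj) 2
    _ ≤ x 0 := ((memX_iff_sum_range_le x).1 hx).2 n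

theorem memX.apply_le {x : ℕ →ᵇ ℝ} (hx : memX x) (n : ℕ) : x n ≤ x 0 + 1 := by
  rcases n with _ | n
  · linarith
  · have h := hx.mul_sq_le (n + 1)
    push_cast at h
    nlinarith [mul_nonneg n.cast_nonneg (sq_nonneg (x (n + 1))), sq_nonneg (x (n + 1) - 1),
      hx.nonneg 0]

/-- `X` is closed under pointwise limits. -/
theorem memX_of_tendsto {u : ℕ → ℕ →ᵇ ℝ} {y : ℕ →ᵇ ℝ} (hu : ∀ k, memX (u k))
    (hy : ∀ n, Tendsto (fun k => u k n) atTop (nhds (y n))) : memX y := by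
  refine (memX_iff_sum_range_le y).2 ⟨fun j hj => ⟨?_, ?_⟩, fun n => ?_⟩
  · exact ge_of_tendsto' (hy _) fun k => (hu k).nonneg _
  · exact le_of_tendsto_of_tendsto' (hy _) (hy _) fun k => ((hu k).1 j hj).2
  · exact le_of_tendsto_of_tendsto' (tendsto_finsetSum _ fun j _ => (hy (j + 1)).pow 2) (hy 0)
      fun k => ((memX_iff_sum_range_le _).1 (hu k)).2 n

/-- On a sublevel set of `x_0` in `X`, pointwise convergence implies uniform convergence. -/
theorem tendsto_of_memX_of_tendsto_apply {t : ℝ} {u : ℕ → ℕ →ᵇ ℝ} {y : ℕ →ᵇ ℝ}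
    (hu : ∀ k, memX (u k) ∧ u k 0 ≤ t) (hyX : memX y ∧ y 0 ≤ t)
    (hy : ∀ n, Tendsto (fun k => u k n) atTop (nhds (y n))) :
    Tendsto u atTop (nhds y) := by
  refine Metric.nhds_basis_closedBall.tendsto_right_iff.2 fun ε hε => ?_
  obtain ⟨N, hN⟩ := exists_nat_gt (t / ε ^ 2)
  rw [div_lt_iff₀ (by positivity)] at hN
  have tail : ∀ x : ℕ →ᵇ ℝ, memX x ∧ x 0 ≤ t → ∀ n, N ≤ n → x n ≤ ε := by
    intro x hx n hn
    by_contra! hlt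
    have hsq : ε ^ 2 ≤ (x n) ^ 2 := pow_le_pow_left₀ hε.le hlt.le 2
    have hmul : (N : ℝ) * ε ^ 2 ≤ n * (x n) ^ 2 := by gcongr
    linarith [hx.1.mul_sq_le n, hx.2]
  have head : ∀ᶠ k in atTop, ∀ n ∈ Finset.range N, dist (u k n) (y n) ≤ ε :=
    (Finset.eventually_all _).2 fun n _ =>
      (hy n).eventually (Metric.closedBall_mem_nhds _ hε)
  filter_upwards [head] with k hk
  refine (BoundedContinuousFunction.dist_le hε.le).2 fun n => ?_
  rcases lt_or_ge n N with hn | hn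
  · exact hk n (Finset.mem_range.2 hn)
  · rw [Real.dist_eq, abs_le]
    constructor <;>
      linarith [tail _ (hu k) n hn, tail y hyX n hn, (hu k).1.nonneg n, hyX.1.nonneg n]

theorem stmt14 (t : ℝ) :
    IsCompact {x : ℕ →ᵇ ℝ | memX x ∧ x 0 ≤ t} := by
  refine IsSeqCompact.isCompact fun u hu => ?_
  have hbox : ∀ k, (u k : ℕ → ℝ) ∈ Set.univ.pi fun _ => Set.Icc 0 (t + 1) := fun k n _ =>
    ⟨(hu k).1.nonneg n, ((hu k).1.apply_le n).trans (by linarith [(hu k).2])⟩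
  obtain ⟨z, hz, φ, hφ, hlim⟩ :=
    (isCompact_univ_pi fun _ : ℕ => isCompact_Icc).tendsto_subseq hbox
  let y : ℕ →ᵇ ℝ := ofNormedAddCommGroupDiscrete z (t + 1) fun n => by
    rw [Real.norm_of_nonneg (hz n trivial).1]
    exact (hz n trivial).2
  have hy : ∀ n, Tendsto (fun k => u (φ k) n) atTop (nhds (y n)) := tendsto_pi_nhds.1 hlim
  have hyX : memX y ∧ y 0 ≤ t :=
    ⟨memX_of_tendsto (fun k => (hu (φ k)).1) hy, le_of_tendsto' (hy 0) fun k => (hu (φ k)).2⟩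
  exact ⟨y, hyX, φ, hφ, tendsto_of_memX_of_tendsto_apply (fun k => hu (φ k)) hyX hy⟩
end
end

section
/- The rate function I is good: for every t ∈ ℝ, the level set {x ∈ X : I(x) ≤ t} is a compact subset of (X,d). In particular, I is lower semicontinuous, and for all x ∈ X one has I(x) ≥ x_0/2 − ln 2, so that {I ≤ t} ⊆ {x ∈ X : x_0 ≤ 2(t + ln 2)}. -/
open MeasureTheory BoundedContinuousFunction Filter

noncomputable section

/-- Order intervals `[0, b]` of sequences are compact in `l^∞` when `b` tends to zero. -/
theorem isCompact_setOf_forall_mem_Icc {b : ℕ → ℝ} (hb : Tendsto b atTop (nhds 0)) :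
    IsCompact {x : ℕ →ᵇ ℝ | ∀ j, x j ∈ Set.Icc 0 (b j)} := by
  obtain ⟨B, hB⟩ := hb.bddAbove_range
  rw [isCompact_iff_ultrafilter_le_nhds]
  intro U hU
  have hUS : ∀ᶠ x : ℕ →ᵇ ℝ in U, ∀ j, x j ∈ Set.Icc 0 (b j) := le_principal_iff.1 hU
  have hcoord : ∀ j, ∃ a ∈ Set.Icc 0 (b j), Tendsto (fun x : ℕ →ᵇ ℝ => x j) U (nhds a) := by
    intro j
    refine isCompact_iff_ultrafilter_le_nhds.1 (isCompact_Icc (a := (0 : ℝ)) (b := b j))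
      (U.map fun x => x j) (le_principal_iff.2 ?_)
    exact hUS.mono fun x hx => hx j
  choose f hf hlim using hcoord
  let g : ℕ →ᵇ ℝ := BoundedContinuousFunction.ofNormedAddCommGroupDiscrete f B fun j => by
    rw [Real.norm_of_nonneg (hf j).1]
    exact (hf j).2.trans (hB ⟨j, rfl⟩)
  refine ⟨g, hf, ?_⟩
  change Tendsto id (U : Filter (ℕ →ᵇ ℝ)) (nhds g)
  rw [Metric.tendsto_nhds]
  intro ε hε
  obtain ⟨N, hN⟩ := eventually_atTop.1 (hb.eventually (gt_mem_nhds (half_pos hε)))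
  have hfin : ∀ᶠ x : ℕ →ᵇ ℝ in U, ∀ j ∈ Finset.range N, dist (x j) (f j) < ε / 2 :=
    (Finset.eventually_all _).2 fun j _ => Metric.tendsto_nhds.1 (hlim j) _ (half_pos hε)
  filter_upwards [hUS, hfin] with x hx hxN
  refine lt_of_le_of_lt ((dist_le (half_pos hε).le).2 fun j => ?_) (half_lt_self hε)
  by_cases hj : j < N
  · exact (hxN j (Finset.mem_range.2 hj)).le
  · have hbj := hN j (not_lt.1 hj)
    have hxj := hx j
    have hfj := hf j
    change |x j - f j| ≤ ε / 2
    rw [abs_le]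
    constructor <;> linarith [hxj.1, hxj.2, hfj.1, hfj.2]

theorem Ifun_le_coe_iff (x : ℕ →ᵇ ℝ) (t : ℝ) :
    Ifun x ≤ (t : EReal) ↔ Real.exp (x 0 - 1 - t) ≤ Jfun x := by
  unfold Ifun
  split_ifs with h
  · rw [EReal.coe_le_coe_iff, ← Real.le_log_iff_exp_le h]
    constructor <;> intro h' <;> linarith
  · refine iff_of_false (by simp) fun h' => h ((Real.exp_pos _).trans_le h')

/-- Sublevel sets of `Ifun` are cut out by inequalities involving finitely many coordinates. -/
theorem mem_setX_and_Ifun_le_iff (x : ℕ →ᵇ ℝ) (t : ℝ) :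
    x ∈ setX ∧ Ifun x ≤ (t : EReal) ↔
      (∀ j : ℕ, 1 ≤ j → 0 ≤ x (j + 1) ∧ x (j + 1) ≤ x j) ∧
      ∀ n : ℕ, ∑ j ∈ Finset.range n, x (j + 1) ^ 2 ≤ x 0 - Real.exp (x 0 - 1 - t) := by
  rw [Ifun_le_coe_iff]
  unfold Jfun
  constructor
  · rintro ⟨⟨hmono, hsum, -⟩, hJ⟩
    refine ⟨hmono, fun n => ?_⟩
    linarith [hsum.sum_le_tsum (Finset.range n) fun j _ => sq_nonneg (x (j + 1))]
  · rintro ⟨hmono, hbound⟩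
    have hsum : Summable fun j : ℕ => x (j + 1) ^ 2 :=
      summable_of_sum_range_le (fun j => sq_nonneg _) hbound
    have hle := Real.tsum_le_of_sum_range_le (fun j => sq_nonneg (x (j + 1))) hbound
    exact ⟨⟨hmono, hsum, by linarith [Real.exp_pos (x 0 - 1 - t)]⟩, by linarith⟩

theorem isClosed_sublevel_Ifun (t : ℝ) :
    IsClosed {x : ℕ →ᵇ ℝ | x ∈ setX ∧ Ifun x ≤ (t : EReal)} := by
  have hc : ∀ j : ℕ, Continuous fun x : ℕ →ᵇ ℝ => x j := fun j => continuous_eval_const j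
  simp only [mem_setX_and_Ifun_le_iff, Set.ofPred_and, Set.ofPred_forall]
  refine IsClosed.inter ?_ ?_
  · refine isClosed_iInter fun j => isClosed_iInter fun _ => ?_
    exact (isClosed_le continuous_const (hc _)).inter (isClosed_le (hc _) (hc _))
  · refine isClosed_iInter fun n => isClosed_le ?_ ?_
    · exact continuous_finsetSum _ fun j _ => (hc _).pow 2
    · exact (hc 0).sub (Real.continuous_exp.comp (((hc 0).sub continuous_const).sub
        continuous_const))

theorem half_sub_log_two_le_Ifun (x : ℕ →ᵇ ℝ) :
    ((x 0 / 2 - Real.log 2 : ℝ) : EReal) ≤ Ifun x := by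
  unfold Ifun
  split_ifs with h
  · rw [EReal.coe_le_coe_iff]
    have hJ : Jfun x ≤ x 0 := sub_le_self _ (tsum_nonneg fun j => sq_nonneg _)
    have hlog : Real.log (x 0) = Real.log (x 0 / 2) + Real.log 2 := by
      rw [Real.log_div (h.trans_le hJ).ne' two_ne_zero, sub_add_cancel]
    linarith [Real.log_le_log h hJ, Real.log_le_sub_one_of_pos (half_pos (h.trans_le hJ))]
  · exact le_top

theorem apply_zero_le_of_Ifun_le {x : ℕ →ᵇ ℝ} {t : ℝ} (h : Ifun x ≤ (t : EReal)) :
    x 0 ≤ 2 * (t + Real.log 2) := by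
  have := EReal.coe_le_coe_iff.1 ((half_sub_log_two_le_Ifun x).trans h)
  linarith

theorem memX.succ_nonneg {x : ℕ →ᵇ ℝ} (hx : memX x) (j : ℕ) : 0 ≤ x (j + 1) :=
  (hx.1 (j + 1) (by omega)).1.trans (hx.1 (j + 1) (by omega)).2

theorem memX.succ_le_sqrt {x : ℕ →ᵇ ℝ} (hx : memX x) (j : ℕ) :
    x (j + 1) ≤ √(x 0 / ((j + 1 : ℕ) : ℝ)) := by
  have hanti : Antitone fun i : ℕ => x (i + 1) :=
    antitone_nat_of_succ_le fun i => (hx.1 (i + 1) (by omega)).2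
  refine Real.le_sqrt_of_sq_le ?_
  rw [le_div_iff₀ (by positivity)]
  calc x (j + 1) ^ 2 * ((j + 1 : ℕ) : ℝ)
      = ∑ _i ∈ Finset.range (j + 1), x (j + 1) ^ 2 := by
        rw [Finset.sum_const, Finset.card_range, nsmul_eq_mul, mul_comm]
    _ ≤ ∑ i ∈ Finset.range (j + 1), x (i + 1) ^ 2 :=
        Finset.sum_le_sum fun i hi => pow_le_pow_left₀ (hx.succ_nonneg j)
          (hanti (Nat.lt_succ_iff.1 (Finset.mem_range.1 hi))) 2
    _ ≤ ∑' i : ℕ, x (i + 1) ^ 2 := hx.2.1.sum_le_tsum _ fun i _ => sq_nonneg _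
    _ ≤ x 0 := hx.2.2

theorem isCompact_sublevel_Ifun (t : ℝ) :
    IsCompact {x : ℕ →ᵇ ℝ | x ∈ setX ∧ Ifun x ≤ (t : EReal)} := by
  set C := 2 * (t + Real.log 2)
  let b : ℕ → ℝ := fun j => if j = 0 then C else √(C / (j : ℝ))
  have hb : Tendsto b atTop (nhds 0) := by
    have hsqrt : Tendsto (fun j : ℕ => √(C / (j : ℝ))) atTop (nhds 0) := by
      simpa using (tendsto_const_div_atTop_nhds_zero_nat C).sqrt
    refine hsqrt.congr' ?_
    filter_upwards [eventually_ne_atTop 0] with j hj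
    exact (if_neg hj).symm
  refine (isCompact_setOf_forall_mem_Icc hb).of_isClosed_subset (isClosed_sublevel_Ifun t) ?_
  rintro x ⟨hx, hI⟩ j
  have hxC : x 0 ≤ C := apply_zero_le_of_Ifun_le hI
  cases j with
  | zero => exact ⟨(tsum_nonneg fun j => sq_nonneg (x (j + 1))).trans hx.2.2, hxC⟩
  | succ j =>
    refine ⟨memX.succ_nonneg hx j, (memX.succ_le_sqrt hx j).trans ?_⟩
    change _ ≤ √(C / ((j + 1 : ℕ) : ℝ))
    gcongr

theorem lowerSemicontinuousOn_Ifun : LowerSemicontinuousOn Ifun setX := by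
  intro x hx y hy
  obtain ⟨t, hyt, htx⟩ := EReal.lt_iff_exists_real_btwn.1 hy
  have hmem : {x : ℕ →ᵇ ℝ | x ∈ setX ∧ Ifun x ≤ (t : EReal)}ᶜ ∈ nhds x :=
    (isClosed_sublevel_Ifun t).isOpen_compl.mem_nhds fun h => htx.not_ge h.2
  filter_upwards [mem_nhdsWithin_of_mem_nhds hmem, self_mem_nhdsWithin] with z hz hzX
  exact hyt.trans (not_le.1 fun h => hz ⟨hzX, h⟩)

theorem stmt15 :
    (∀ t : ℝ, IsCompact {x : ℕ →ᵇ ℝ | x ∈ setX ∧ Ifun x ≤ (t : EReal)}) ∧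
    LowerSemicontinuousOn Ifun setX ∧
    (∀ x ∈ setX, ((x 0 / 2 - Real.log 2 : ℝ) : EReal) ≤ Ifun x) ∧
    (∀ t : ℝ, {x : ℕ →ᵇ ℝ | x ∈ setX ∧ Ifun x ≤ (t : EReal)} ⊆
      {x : ℕ →ᵇ ℝ | x ∈ setX ∧ x 0 ≤ 2 * (t + Real.log 2)}) := by
  exact ⟨isCompact_sublevel_Ifun, lowerSemicontinuousOn_Ifun,
    fun x _ => half_sub_log_two_le_Ifun x, fun _ _ hx => ⟨hx.1, apply_zero_le_of_Ifun_le hx.2⟩⟩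
end
end

section
/- The map φ : X → M_1(ℝ) is continuous: if x^k → x^0 in (X,d) as k → ∞, then d_BL(φ(x^k), φ(x^0)) → 0; equivalently, the characteristic functions converge pointwise: for every s ∈ ℝ, e^{−J(x^k)s²/2} ∏_{j=1}^∞ cos(s x_j^k) → e^{−J(x^0)s²/2} ∏_{j=1}^∞ cos(s x_j^0). -/
open MeasureTheory BoundedContinuousFunction Filter

noncomputable section

open scoped Topology

theorem abs_cos_sub_one_sub_sq_half_le (u : ℝ) :
    |Real.cos u - (1 - u ^ 2 / 2)| ≤ u ^ 4 / 2 := by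
  rcases le_total |u| 1 with h | h
  · refine (Real.cos_bound h).trans ?_
    rw [pow_abs, abs_of_nonneg (by positivity)]
    nlinarith [show 0 ≤ u ^ 4 by positivity]
  · have hu : 1 ≤ u ^ 2 := (one_le_sq_iff_one_le_abs u).2 h
    rw [abs_of_nonneg (by linarith [Real.one_sub_sq_div_two_le_cos (x := u)])]
    nlinarith [Real.cos_le_one u]

theorem abs_exp_neg_sub_one_sub_le {v : ℝ} (hv : 0 ≤ v) :
    |Real.exp (-v) - (1 - v)| ≤ v ^ 2 := by
  have h1 := Real.add_one_le_exp (-v)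
  have h2 := Real.add_one_le_exp v
  have h3 : Real.exp (-v) * Real.exp v = 1 := by rw [← Real.exp_add]; simp
  have h4 : Real.exp (-v) * (v + 1) ≤ 1 :=
    (mul_le_mul_of_nonneg_left h2 (Real.exp_pos _).le).trans_eq h3
  rw [abs_of_nonneg (by linarith)]
  have h5 : (Real.exp (-v) - (1 - v + v ^ 2)) * (v + 1) ≤ 0 := by
    nlinarith [pow_nonneg hv 3]
  nlinarith [nonpos_of_mul_nonpos_left h5 (by linarith)]

/-- The factor `cos u · e^{u²/2}` differs from `1` only at fourth order. -/
theorem abs_cos_mul_exp_sq_half_sub_one_le (u : ℝ) :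
    |Real.cos u * Real.exp (u ^ 2 / 2) - 1| ≤ u ^ 4 * Real.exp (u ^ 2 / 2) := by
  have h1 := abs_cos_sub_one_sub_sq_half_le u
  have h2 := abs_exp_neg_sub_one_sub_le (v := u ^ 2 / 2) (by positivity)
  have h3 : |Real.cos u - Real.exp (-(u ^ 2 / 2))| ≤ u ^ 4 := by
    rw [abs_le] at *
    constructor <;> nlinarith [show 0 ≤ u ^ 4 by positivity]
  have h4 : Real.cos u * Real.exp (u ^ 2 / 2) - 1
      = (Real.cos u - Real.exp (-(u ^ 2 / 2))) * Real.exp (u ^ 2 / 2) := by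
    rw [sub_mul, ← Real.exp_add]; simp
  rw [h4, abs_mul, Real.abs_exp]
  gcongr

/-- Monotonicity forces `x_{j+1}² ≤ x_0 / (j+1)` on `X`. -/
theorem memX.sq_le {x : ℕ →ᵇ ℝ} (hx : memX x) (j : ℕ) :
    (x (j + 1)) ^ 2 ≤ x 0 / (j + 1) := by
  obtain ⟨hmono, hsum, hle⟩ := hx
  have hanti : Antitone fun j : ℕ => x (j + 1) :=
    antitone_nat_of_succ_le fun n => (hmono (n + 1) (by omega)).2
  have hnonneg (n : ℕ) : 0 ≤ x (n + 1) :=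
    (hmono (n + 1) (by omega)).1.trans (hmono (n + 1) (by omega)).2
  have hconst : ((j : ℝ) + 1) * (x (j + 1)) ^ 2
      ≤ ∑ i ∈ Finset.range (j + 1), (x (i + 1)) ^ 2 := by
    have := Finset.card_nsmul_le_sum (Finset.range (j + 1)) (fun i => (x (i + 1)) ^ 2)
      ((x (j + 1)) ^ 2) fun i hi =>
        pow_le_pow_left₀ (hnonneg j) (hanti (by simpa [Nat.lt_succ_iff] using hi)) 2
    simpa using this
  rw [le_div_iff₀ (by positivity), mul_comm]
  exact hconst.trans ((hsum.sum_le_tsum _ fun _ _ => sq_nonneg _).trans hle)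

/-- The summand bound used to dominate the infinite product. -/
theorem memX.abs_cos_mul_exp_sub_one_le {x : ℕ →ᵇ ℝ} (hx : memX x) {R : ℝ} (hR : x 0 ≤ R)
    (s : ℝ) (j : ℕ) :
    |Real.cos (s * x (j + 1)) * Real.exp ((s * x (j + 1)) ^ 2 / 2) - 1|
      ≤ s ^ 4 * R ^ 2 * Real.exp (s ^ 2 * R / 2) * (1 / ((j : ℝ) + 1) ^ 2) := by
  have hx0 : 0 ≤ x 0 := (tsum_nonneg fun _ => sq_nonneg _).trans hx.2.2
  have hsq : (x (j + 1)) ^ 2 ≤ R / (j + 1) := (hx.sq_le j).trans (by gcongr)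
  have hsqR : (x (j + 1)) ^ 2 ≤ R :=
    hsq.trans (div_le_self (hx0.trans hR) (by linarith [Nat.cast_nonneg (α := ℝ) j]))
  refine (abs_cos_mul_exp_sq_half_sub_one_le _).trans ?_
  calc (s * x (j + 1)) ^ 4 * Real.exp ((s * x (j + 1)) ^ 2 / 2)
      = s ^ 4 * ((x (j + 1)) ^ 2) ^ 2 * Real.exp (s ^ 2 * (x (j + 1)) ^ 2 / 2) := by
        rw [mul_pow s _ 2]; ring
    _ ≤ s ^ 4 * (R / (j + 1)) ^ 2 * Real.exp (s ^ 2 * R / 2) := by gcongr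
    _ = _ := by rw [div_pow]; ring

theorem summable_const_mul_one_div_succ_sq (C : ℝ) :
    Summable fun j : ℕ => C * (1 / ((j : ℝ) + 1) ^ 2) := by
  refine Summable.mul_left C ?_
  simpa using (summable_nat_add_iff 1).2 (Real.summable_one_div_nat_pow.2 one_lt_two)

/-- The Fourier transform of `φ(x)`, with the Gaussian variance absorbed into the product. -/
theorem memX.exp_mul_tprod_cos_eq {x : ℕ →ᵇ ℝ} (hx : memX x) (s : ℝ) :
    Real.exp (-(Jfun x) * s ^ 2 / 2) * ∏' j : ℕ, Real.cos (s * x (j + 1))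
      = Real.exp (-(x 0) * s ^ 2 / 2) * ∏' j : ℕ,
        (1 + (Real.cos (s * x (j + 1)) * Real.exp ((s * x (j + 1)) ^ 2 / 2) - 1)) := by
  have hmul := (multipliable_one_add_of_summable
    (f := fun j : ℕ => Real.cos (s * x (j + 1)) * Real.exp ((s * x (j + 1)) ^ 2 / 2) - 1)
    ((summable_const_mul_one_div_succ_sq _).of_nonneg_of_le (fun _ => norm_nonneg _)
      fun j => hx.abs_cos_mul_exp_sub_one_le le_rfl s j)).hasProd
  have hexp : HasProd (fun j : ℕ => Real.exp (-(s ^ 2 / 2) * (x (j + 1)) ^ 2))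
      (Real.exp (-(s ^ 2 / 2) * ∑' j : ℕ, (x (j + 1)) ^ 2)) :=
    (hx.2.1.hasSum.mul_left _).rexp
  have hfactor (j : ℕ) :
      (1 + (Real.cos (s * x (j + 1)) * Real.exp ((s * x (j + 1)) ^ 2 / 2) - 1))
        * Real.exp (-(s ^ 2 / 2) * (x (j + 1)) ^ 2) = Real.cos (s * x (j + 1)) := by
    rw [add_sub_cancel, mul_assoc, ← Real.exp_add]
    ring_nf
    simp
  have hcos := hmul.mul hexp
  simp only [hfactor] at hcos
  rw [hcos.tprod_eq, mul_left_comm, ← Real.exp_add, mul_comm, Jfun]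
  ring_nf

/-- Pointwise continuity on `X` of the Fourier transforms. -/
theorem continuousOn_exp_mul_tprod_cos (s : ℝ) :
    ContinuousOn (fun x : ℕ →ᵇ ℝ =>
      Real.exp (-(Jfun x) * s ^ 2 / 2) * ∏' j : ℕ, Real.cos (s * x (j + 1))) setX := by
  refine ContinuousOn.congr (f := fun x : ℕ →ᵇ ℝ => Real.exp (-(x 0) * s ^ 2 / 2) * ∏' j : ℕ,
    (1 + (Real.cos (s * x (j + 1)) * Real.exp ((s * x (j + 1)) ^ 2 / 2) - 1))) ?_
    fun x hx => memX.exp_mul_tprod_cos_eq hx s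
  have heval (n : ℕ) : Continuous fun x : ℕ →ᵇ ℝ => x n := continuous_eval_const n
  refine ContinuousOn.mul (Continuous.continuousOn (by fun_prop)) fun x hx => ?_
  refine tendsto_tprod_one_add_of_dominated_convergence
    (summable_const_mul_one_div_succ_sq
      (s ^ 4 * (x 0 + 1) ^ 2 * Real.exp (s ^ 2 * (x 0 + 1) / 2))) (fun j => ?_) ?_
  · exact Continuous.continuousWithinAt (by fun_prop)
  · have hnear : ∀ᶠ y : ℕ →ᵇ ℝ in 𝓝[setX] x, y 0 < x 0 + 1 :=
      nhdsWithin_le_nhds ((heval 0).continuousAt.eventually_lt_const (lt_add_one _))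
    filter_upwards [hnear, self_mem_nhdsWithin] with y hy hyX j
    exact memX.abs_cos_mul_exp_sub_one_le hyX hy.le s j

/-- `φ : X → M_1(ℝ)` is continuous, where `φ(x)` is characterized by its Fourier transform
`s ↦ e^{−J(x)s²/2} ∏_{j=1}^∞ cos(s x_j)`, and `M_1(ℝ)` carries the topology of weak
convergence (the topology of the bounded Lipschitz metric `d_BL`). -/
theorem stmt18 (φ : (ℕ →ᵇ ℝ) → ProbabilityMeasure ℝ)
    (hφ : ∀ x ∈ setX, ∀ s : ℝ,
      ∫ t : ℝ, Complex.exp (Complex.I * (s : ℂ) * (t : ℂ)) ∂(φ x : Measure ℝ)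
        = ((Real.exp (-(Jfun x) * s ^ 2 / 2)
            * ∏' j : ℕ, Real.cos (s * x (j + 1)) : ℝ) : ℂ)) :
    ContinuousOn φ setX := by
  intro x hx
  refine tendsto_of_seq_tendsto fun u hu =>
    ProbabilityMeasure.tendsto_of_tendsto_charFun fun s => ?_
  have hchar (y : ℕ →ᵇ ℝ) (hy : y ∈ setX) : charFun (φ y : Measure ℝ) s
      = ((Real.exp (-(Jfun y) * s ^ 2 / 2) * ∏' j : ℕ, Real.cos (s * y (j + 1)) : ℝ) : ℂ) := by
    rw [← hφ y hy s, charFun_apply_real]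
    congr with t
    ring_nf
  rw [hchar x hx]
  have hlim := (Complex.continuous_ofReal.tendsto _).comp
    ((continuousOn_exp_mul_tprod_cos s x hx).tendsto.comp hu)
  refine hlim.congr' ?_
  filter_upwards [hu.eventually self_mem_nhdsWithin] with n hn
  exact (hchar (u n) hn).symm
end
end
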